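/- Let 𝒟 be a finite family of m ≥ 3 convex pseudo-disks in the plane whose union covers the entire plane. Then there exists a finite set V of O(m) points and a triangulation T of the plane with vertex set V such that every triangle Δ ∈ T is fully contained in some member of 𝒟. -/

import Mathlib

open scoped Classical

/-- A closed halfplane in `ℝ²`. -/
def IsClosedHalfplane (h : Set (Fin 2 → ℝ)) : Prop :=
  ∃ v : Fin 2 → ℝ, v ≠ 0 ∧ ∃ c : ℝ, h = {x | v 0 * x 0 + v 1 * x 1 ≤ c}

/-- A (possibly unbounded or degenerate) triangle: an intersection of three
closed halfplanes.  Unbounded triangles are bounded by one segment and two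
rays (wedges are a degenerate case). -/
def IsTriangleLike (Δ : Set (Fin 2 → ℝ)) : Prop :=
  ∃ h₁ h₂ h₃ : Set (Fin 2 → ℝ),
    IsClosedHalfplane h₁ ∧ IsClosedHalfplane h₂ ∧ IsClosedHalfplane h₃ ∧
    Δ = h₁ ∩ h₂ ∩ h₃

/-- A cap of a convex set `D`: its intersection with a closed halfplane. -/
def IsCapOf (D R : Set (Fin 2 → ℝ)) : Prop :=
  ∃ h : Set (Fin 2 → ℝ), IsClosedHalfplane h ∧ R = D ∩ h

/-- A family of convex pseudo-disks: closed convex sets such that for any two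
members `C, D`, both `C \ D` and `D \ C` are connected. -/
def IsPseudoDiskFamily (𝒟 : Finset (Set (Fin 2 → ℝ))) : Prop :=
  (∀ D ∈ 𝒟, Convex ℝ D ∧ IsClosed D) ∧
  (∀ C ∈ 𝒟, ∀ D ∈ 𝒟, IsPreconnected (C \ D))

/-- The Euclidean plane, as it appears in the statement. -/
abbrev Plane : Type := Fin 2 → ℝ

/-- Two sets are noncrossing if no segment with both ends in `C \ D` meets a segment with both
ends in `D \ C`. -/
def Noncrossing (C D : Set Plane) : Prop :=
  ∀ a₁ ∈ C \ D, ∀ a₂ ∈ C \ D, ∀ b₁ ∈ D \ C, ∀ b₂ ∈ D \ C,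
    ∀ q ∈ segment ℝ a₁ a₂, q ∉ segment ℝ b₁ b₂

theorem Noncrossing.symm {C D : Set Plane} (h : Noncrossing C D) : Noncrossing D C :=
  fun a₁ ha₁ a₂ ha₂ b₁ hb₁ b₂ hb₂ q hq hq' => h b₁ hb₁ b₂ hb₂ a₁ ha₁ a₂ ha₂ q hq' hq

theorem sum_smul_mem_segment {ι : Type*} {S : Finset ι} {v : ι → ℝ} {y : ι → Plane}
    (hv : ∀ i ∈ S, 0 ≤ v i) (hsum : ∑ i ∈ S, v i = 1) (hcard : S.card ≤ 2) :
    ∃ i ∈ S, ∃ j ∈ S, ∑ i ∈ S, v i • y i ∈ segment ℝ (y i) (y j) := by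
  have hne : S.Nonempty := by
    rw [Finset.nonempty_iff_ne_empty]
    rintro rfl
    simp at hsum
  have hpos := hne.card_pos
  obtain h1 | h2 : S.card = 1 ∨ S.card = 2 := by omega
  · obtain ⟨i, rfl⟩ := Finset.card_eq_one.1 h1
    refine ⟨i, by simp, i, by simp, ?_⟩
    simp only [Finset.sum_singleton] at hsum ⊢
    simp [hsum]
  · obtain ⟨i, j, hij, rfl⟩ := Finset.card_eq_two.1 h2
    refine ⟨i, by simp, j, by simp, ?_⟩
    rw [Finset.sum_pair hij] at hsum ⊢
    exact ⟨v i, v j, hv i (by simp), hv j (by simp), hsum, rfl⟩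

/-- Kirchberger's theorem for the two differences of a pair of convex sets. -/
theorem disjoint_convexHull_of_noncrossing {C D : Set Plane} (hC : Convex ℝ C)
    (hD : Convex ℝ D) (h : Noncrossing C D) :
    Disjoint (convexHull ℝ (C \ D)) (convexHull ℝ (D \ C)) := by
  rw [Set.disjoint_left]
  intro x hxA hxB
  set s : Set (Plane × ℝ) :=
    (fun a => (a, (1 : ℝ))) '' (C \ D) ∪ (fun b => (-b, (-1 : ℝ))) '' (D \ C) with hs
  have hconv := convex_convexHull ℝ s
  have hx1 : (x, (1 : ℝ)) ∈ convexHull ℝ s := by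
    have : convexHull ℝ (C \ D) ⊆ {y | (y, (1 : ℝ)) ∈ convexHull ℝ s} := by
      refine convexHull_min (fun a ha => subset_convexHull ℝ s (Or.inl ⟨a, ha, rfl⟩)) ?_
      intro y hy z hz a b ha hb hab
      have := hconv hy hz ha hb hab
      simpa [hab] using this
    exact this hxA
  have hx2 : (-x, (-1 : ℝ)) ∈ convexHull ℝ s := by
    have : convexHull ℝ (D \ C) ⊆ {y | (-y, (-1 : ℝ)) ∈ convexHull ℝ s} := by
      refine convexHull_min (fun a ha => subset_convexHull ℝ s (Or.inr ⟨a, ha, rfl⟩)) ?_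
      intro y hy z hz a b ha hb hab
      have := hconv hy hz ha hb hab
      have e : -a - b = -1 := by linarith
      have e2 : -a + -b = -1 := by linarith
      simpa [e, e2, add_comm] using this
    exact this hxB
  have h0 : (0 : Plane × ℝ) ∈ convexHull ℝ s := by
    have := hconv hx1 hx2 (a := 1 / 2) (b := 1 / 2) (by norm_num) (by norm_num) (by norm_num)
    rw [← Prod.mk_zero_zero]
    simpa using this
  obtain ⟨ι, _, z, w, hz, hind, hw, hw1, hwz⟩ := eq_pos_convex_span_of_mem_convexHull h0
  have hcard : Fintype.card ι ≤ 4 := by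
    refine hind.card_le_finrank_succ.trans ?_
    have := Submodule.finrank_le (vectorSpan ℝ (Set.range z))
    have h3 : Module.finrank ℝ (Plane × ℝ) = 3 := by simp
    exact Nat.add_le_add_right (this.trans_eq h3) 1
  have hzi : ∀ i, ((z i).2 = 1 ∧ (z i).1 ∈ C \ D) ∨ ((z i).2 = -1 ∧ -(z i).1 ∈ D \ C) := by
    intro i
    rcases hz ⟨i, rfl⟩ with ⟨a, ha, e⟩ | ⟨b, hb, e⟩
    · exact Or.inl (by rw [← e]; exact ⟨rfl, ha⟩)
    · exact Or.inr (by rw [← e]; exact ⟨rfl, by simpa using hb⟩)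
  set P : Finset ι := Finset.univ.filter fun i => (z i).2 = 1 with hP
  set y : ι → Plane := fun i => (z i).2 • (z i).1 with hy
  have hPA : ∀ i ∈ P, y i ∈ C \ D := by
    intro i hi
    rcases hzi i with ⟨h1, h2⟩ | ⟨h1, h2⟩
    · simpa [hy, h1] using h2
    · simp [hP, h1] at hi; norm_num at hi
  have hPm : ∀ i ∈ P, (z i).2 = 1 := by intro i hi; simpa [hP] using hi
  have hQm : ∀ i ∈ Pᶜ, (z i).2 = -1 := by
    intro i hi
    rcases hzi i with ⟨h1, h2⟩ | ⟨h1, h2⟩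
    · simp [hP, h1] at hi
    · exact h1
  have hQB : ∀ i ∈ Pᶜ, y i ∈ D \ C := by
    intro i hi
    rcases hzi i with ⟨h1, h2⟩ | ⟨h1, h2⟩
    · simp [hP, h1] at hi
    · simpa [hy, h1] using h2
  have hs2 : ∑ i, w i * (z i).2 = 0 := by
    have := congrArg Prod.snd hwz
    simpa [Prod.snd_sum] using this
  have hs1 : ∑ i, w i • (z i).1 = 0 := by
    have := congrArg Prod.fst hwz
    simpa [Prod.fst_sum] using this
  rw [← Finset.sum_add_sum_compl P] at hs1 hs2 hw1
  have e1 : ∑ i ∈ P, w i * (z i).2 = ∑ i ∈ P, w i :=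
    Finset.sum_congr rfl fun i hi => by rw [hPm i hi, mul_one]
  have e2 : ∑ i ∈ Pᶜ, w i * (z i).2 = -∑ i ∈ Pᶜ, w i := by
    rw [← Finset.sum_neg_distrib]
    exact Finset.sum_congr rfl fun i hi => by rw [hQm i hi, mul_neg_one]
  have e3 : ∑ i ∈ P, w i • (z i).1 = ∑ i ∈ P, w i • y i :=
    Finset.sum_congr rfl fun i hi => by simp only [hy]; rw [hPm i hi, one_smul]
  have e4 : ∑ i ∈ Pᶜ, w i • (z i).1 = -∑ i ∈ Pᶜ, w i • y i := by
    rw [← Finset.sum_neg_distrib]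
    refine Finset.sum_congr rfl fun i hi => ?_
    simp only [hy]
    rw [hQm i hi, neg_one_smul, smul_neg, neg_neg]
  rw [e1, e2] at hs2
  rw [e3, e4] at hs1
  have hP1 : ∑ i ∈ P, 2 * w i = 1 := by rw [← Finset.mul_sum]; linarith
  have hQ1 : ∑ i ∈ Pᶜ, 2 * w i = 1 := by rw [← Finset.mul_sum]; linarith
  have hw2 : ∀ S : Finset ι, ∀ i ∈ S, 0 ≤ 2 * w i := fun S i _ => by have := hw i; linarith
  have hPQ : ∑ i ∈ P, (2 * w i) • y i = ∑ i ∈ Pᶜ, (2 * w i) • y i := by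
    simp only [mul_smul, ← Finset.smul_sum]
    rw [add_neg_eq_zero.1 hs1]
  have hxC : ∑ i ∈ P, (2 * w i) • y i ∈ C := hC.sum_mem (hw2 P) hP1 fun i hi => (hPA i hi).1
  have hxD : ∑ i ∈ P, (2 * w i) • y i ∈ D := by
    rw [hPQ]; exact hD.sum_mem (hw2 _) hQ1 fun i hi => (hQB i hi).1
  have single : ∀ S : Finset ι, S.card ≤ 1 → ∑ i ∈ S, 2 * w i = 1 →
      ∃ i ∈ S, ∑ i ∈ S, (2 * w i) • y i = y i := by
    intro S hS h1
    have hne : S.Nonempty := by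
      rw [Finset.nonempty_iff_ne_empty]
      rintro rfl
      simp at h1
    have hpos := hne.card_pos
    obtain ⟨i, rfl⟩ := Finset.card_eq_one.1 (le_antisymm hS hpos)
    refine ⟨i, by simp, ?_⟩
    rw [Finset.sum_singleton] at h1 ⊢
    rw [h1, one_smul]
  have hcc := Finset.card_add_card_compl P
  by_cases hp : P.card ≤ 1
  · obtain ⟨i, hi, e⟩ := single P hp hP1
    exact (hPA i hi).2 (e ▸ hxD)
  by_cases hq : Pᶜ.card ≤ 1
  · obtain ⟨i, hi, e⟩ := single Pᶜ hq hQ1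
    rw [hPQ, e] at hxC
    exact (hQB i hi).2 hxC
  obtain ⟨i, hi, j, hj, hij⟩ :=
    sum_smul_mem_segment (y := y) (hw2 P) hP1 (by omega)
  obtain ⟨k, hk, l, hl, hkl⟩ :=
    sum_smul_mem_segment (y := y) (hw2 Pᶜ) hQ1 (by omega)
  exact h _ (hPA i hi) _ (hPA j hj) _ (hQB k hk) _ (hQB l hl) _ hij (hPQ ▸ hkl)

theorem mem_closure_diff_closure {C D : Set Plane} (hC : IsOpen C) (hD : IsOpen D)
    (hDc : Convex ℝ D) {x : Plane} (hx : x ∈ C \ D) : x ∈ closure (C \ closure D) := by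
  rw [mem_closure_iff]
  intro o ho hxo
  by_contra hcon
  rw [Set.not_nonempty_iff_eq_empty] at hcon
  have hsub : o ∩ C ⊆ closure D := by
    intro y hy
    by_contra hyD
    have : y ∈ o ∩ (C \ closure D) := ⟨hy.1, hy.2, hyD⟩
    rw [hcon] at this
    exact this
  have hxi : x ∈ interior (closure D) :=
    interior_maximal hsub (ho.inter hC) ⟨hxo, hx.1⟩
  have hne : (interior D).Nonempty := by
    rw [hD.interior_eq]
    exact closure_nonempty_iff.1 ⟨x, interior_subset hxi⟩
  rw [hDc.interior_closure_eq_interior_of_nonempty_interior hne, hD.interior_eq] at hxi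
  exact hx.2 hxi

/-- The two differences of a noncrossing pair of open convex sets are separated by a line
(or one of them is empty). -/
theorem exists_separating_of_noncrossing {C D : Set Plane} (hC : Convex ℝ C)
    (hD : Convex ℝ D) (hCo : IsOpen C) (hDo : IsOpen D) (h : Noncrossing C D) :
    ∃ (f : Plane →L[ℝ] ℝ) (c : ℝ), (f ≠ 0 ∨ c ≠ 0) ∧
      (∀ x ∈ C \ D, c ≤ f x) ∧ (∀ x ∈ D \ C, f x ≤ c) := by
  rcases (C \ D).eq_empty_or_nonempty with hA | ⟨a, ha⟩
  · exact ⟨0, 1, by simp, by simp [hA], by simp⟩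
  rcases (D \ C).eq_empty_or_nonempty with hB | ⟨b, hb⟩
  · exact ⟨0, -1, by simp, by simp, by simp [hB]⟩
  have hdisj := disjoint_convexHull_of_noncrossing hC hD h
  have hsub : convexHull ℝ (C \ closure D) ⊆ convexHull ℝ (C \ D) :=
    convexHull_mono (Set.sdiff_subset_sdiff_right subset_closure)
  obtain ⟨f, u, hf1, hf2⟩ := geometric_hahn_banach_open (convex_convexHull ℝ (C \ closure D))
    (hCo.sdiff isClosed_closure).convexHull (convex_convexHull ℝ (D \ C)) (hdisj.mono_left hsub)
  have hle : ∀ x ∈ C \ D, f x ≤ u := by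
    intro x hx
    have := mem_closure_diff_closure hCo hDo hD hx
    refine closure_minimal (s := C \ closure D) (t := {x | f x ≤ u}) ?_ ?_ this
    · intro y hy
      exact (hf1 y (subset_convexHull ℝ _ hy)).le
    · exact isClosed_le f.continuous continuous_const
  refine ⟨-f, -u, ?_, fun x hx => by simpa using hle x hx,
    fun x hx => by simpa using hf2 x (subset_convexHull ℝ _ hx)⟩
  left
  intro h0
  obtain ⟨y, hy⟩ := closure_nonempty_iff.1 ⟨a, mem_closure_diff_closure hCo hDo hD ha⟩
  have h1 := hf1 y (subset_convexHull ℝ _ hy)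
  have h2 := hf2 b (subset_convexHull ℝ _ hb)
  have : f = 0 := neg_eq_zero.1 h0
  rw [this] at h1 h2
  simp at h1 h2
  linarith

theorem exists_mem_segment_eq_zero {g : Plane → ℝ}
    (hg : ∀ x y : Plane, ∀ a b : ℝ, a + b = 1 → g (a • x + b • y) = a * g x + b * g y)
    {x y : Plane} (h : g x * g y ≤ 0) : ∃ z ∈ segment ℝ x y, g z = 0 := by
  by_cases hx : g x = 0
  · exact ⟨x, left_mem_segment ℝ x y, hx⟩
  have key : ∀ a b : ℝ, 0 ≤ a → 0 ≤ b → 0 < a + b → a * g x + b * g y = 0 →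
      ∃ z ∈ segment ℝ x y, g z = 0 := by
    intro a b ha hb hab h0
    have h1 : a / (a + b) + b / (a + b) = 1 := by field_simp
    refine ⟨_, ⟨a / (a + b), b / (a + b), by positivity, by positivity, h1, rfl⟩, ?_⟩
    rw [hg _ _ _ _ h1]
    field_simp
    linarith
  rcases lt_or_gt_of_ne hx with hx | hx
  · exact key (g y) (-g x) (by nlinarith) (by linarith) (by nlinarith) (by ring)
  · exact key (-g y) (g x) (by nlinarith) (by linarith) (by nlinarith) (by ring)

/-- If a segment with ends outside a convex set `K` crosses a side `b₁ b₂` of a triangle with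
vertices in `K`, then it also crosses another side. -/
theorem exists_mem_segment_of_crossing {K : Set Plane} (hK : Convex ℝ K)
    {a₁ a₂ b₁ b₂ p q : Plane} (ha₁ : a₁ ∉ K) (ha₂ : a₂ ∉ K) (hb₁ : b₁ ∈ K) (hb₂ : b₂ ∈ K)
    (hp : p ∈ K) (hqa : q ∈ segment ℝ a₁ a₂) (hqb : q ∈ segment ℝ b₁ b₂) :
    ∃ z ∈ segment ℝ a₁ a₂, z ∈ segment ℝ b₁ p ∨ z ∈ segment ℝ b₂ p := by
  have hq : q ∈ K := hK.segment_subset hb₁ hb₂ hqb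
  set g : Plane → ℝ := fun x =>
    (a₂ 0 - a₁ 0) * (x 1 - a₁ 1) - (a₂ 1 - a₁ 1) * (x 0 - a₁ 0) with hgdef
  have hg : ∀ x y : Plane, ∀ a b : ℝ, a + b = 1 →
      g (a • x + b • y) = a * g x + b * g y := by
    intro x y a b hab
    obtain rfl : b = 1 - a := by linarith
    simp only [hgdef, Pi.add_apply, Pi.smul_apply, smul_eq_mul]
    ring
  have hline : ∀ z ∈ K, g z = 0 → z ∈ segment ℝ a₁ a₂ := by
    intro z hz hgz
    obtain ⟨τ, hτ⟩ : ∃ τ : ℝ, z = a₁ + τ • (a₂ - a₁) := by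
      simp only [hgdef] at hgz
      by_cases h0 : a₂ 0 - a₁ 0 = 0
      · by_cases h1 : a₂ 1 - a₁ 1 = 0
        · exfalso
          have : a₂ = a₁ := by
            ext i; fin_cases i
            · exact sub_eq_zero.1 h0
            · exact sub_eq_zero.1 h1
          rw [this, segment_same] at hqa
          rw [Set.mem_singleton_iff.1 hqa] at hq
          exact ha₁ hq
        · refine ⟨(z 1 - a₁ 1) / (a₂ 1 - a₁ 1), ?_⟩
          have hz0 : z 0 - a₁ 0 = 0 := by
            rw [h0] at hgz
            have : (a₂ 1 - a₁ 1) * (z 0 - a₁ 0) = 0 := by linarith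
            exact (mul_eq_zero.1 this).resolve_left h1
          ext i; fin_cases i
          · simp [h0]; linarith
          · simp; field_simp; ring
      · refine ⟨(z 0 - a₁ 0) / (a₂ 0 - a₁ 0), ?_⟩
        ext i; fin_cases i
        · simp; field_simp; ring
        · simp; field_simp; linarith
    obtain ⟨σ, hσ, hσq⟩ : ∃ σ ∈ Set.Icc (0 : ℝ) 1, a₁ + σ • (a₂ - a₁) = q := by
      rw [segment_eq_image'] at hqa
      exact hqa
    rw [segment_eq_image']
    refine ⟨τ, ⟨?_, ?_⟩, hτ.symm⟩
    · by_contra! hneg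
      have hpos : 0 < σ - τ := by linarith [hσ.1]
      have hc := hK hz hq (a := σ / (σ - τ)) (b := -τ / (σ - τ))
        (div_nonneg hσ.1 hpos.le) (div_nonneg (by linarith) hpos.le) (by field_simp; ring)
      refine ha₁ ?_
      convert hc using 1
      rw [hτ, ← hσq]
      ext i
      simp
      field_simp
      ring
    · by_contra! hneg
      have hpos : 0 < τ - σ := by linarith [hσ.2]
      have hc := hK hz hq (a := (1 - σ) / (τ - σ)) (b := (τ - 1) / (τ - σ))
        (div_nonneg (by linarith [hσ.2]) hpos.le) (div_nonneg (by linarith) hpos.le)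
        (by field_simp; ring)
      refine ha₂ ?_
      convert hc using 1
      rw [hτ, ← hσq]
      ext i
      simp
      field_simp
      ring
  have hgq : g q = 0 := by
    obtain ⟨a, b, _, _, hab, rfl⟩ := hqa
    rw [hg _ _ _ _ hab]
    simp only [hgdef]
    ring
  obtain ⟨a, b, ha, hb, hab, hqe⟩ := hqb
  rw [← hqe, hg _ _ _ _ hab] at hgq
  rcases le_total (g b₁ * g p) 0 with h1 | h1
  · obtain ⟨z, hz, hz0⟩ := exists_mem_segment_eq_zero hg h1
    exact ⟨z, hline z (hK.segment_subset hb₁ hp hz) hz0, Or.inl hz⟩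
  rcases le_total (g b₂ * g p) 0 with h2 | h2
  · obtain ⟨z, hz, hz0⟩ := exists_mem_segment_eq_zero hg h2
    exact ⟨z, hline z (hK.segment_subset hb₂ hp hz) hz0, Or.inr hz⟩
  have h3 : a * (g b₁ * g p) + b * (g b₂ * g p) = 0 := by
    have := congrArg (· * g p) hgq
    simp only [zero_mul] at this
    linarith
  have h4 : 0 ≤ a * (g b₁ * g p) := by positivity
  have h5 : 0 ≤ b * (g b₂ * g p) := by positivity
  rcases eq_or_lt_of_le ha with ha0 | ha0
  · have : b = 1 := by linarith
    have h6 : g b₂ * g p = 0 := by rw [this] at h3; rw [← ha0] at h3; linarith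
    obtain ⟨z, hz, hz0⟩ := exists_mem_segment_eq_zero hg h6.le
    exact ⟨z, hline z (hK.segment_subset hb₂ hp hz) hz0, Or.inr hz⟩
  · have h6 : g b₁ * g p = 0 := by
      have : a * (g b₁ * g p) = 0 := by linarith
      exact (mul_eq_zero.1 this).resolve_left ha0.ne'
    obtain ⟨z, hz, hz0⟩ := exists_mem_segment_eq_zero hg h6.le
    exact ⟨z, hline z (hK.segment_subset hb₁ hp hz) hz0, Or.inl hz⟩

/-- Cutting one member of a noncrossing pair by a line keeps the pair noncrossing unless the part
of the other member beyond the line is contained in the uncut set. -/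
theorem Noncrossing.cut_or_subset {C E : Set Plane} (hE : Convex ℝ E) (h : Noncrossing C E)
    (f : Plane →L[ℝ] ℝ) (c : ℝ) :
    Noncrossing (C ∩ {x | c < f x}) E ∨
      ((∀ x ∈ E, f x ≤ c → x ∈ C) ∧ ∃ x ∈ E, x ∈ C ∧ f x ≤ c) := by
  rw [or_iff_not_imp_left]
  intro hcross
  unfold Noncrossing at hcross
  push Not at hcross
  obtain ⟨a₁, ha₁, a₂, ha₂, b₁, hb₁, b₂, hb₂, q, hqa, hqb⟩ := hcross
  have hgt : ∀ z ∈ segment ℝ a₁ a₂, c < f z := fun z hz =>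
    (convex_halfSpace_gt f.toLinearMap.isLinear c).segment_subset ha₁.1.2 ha₂.1.2 hz
  have hle : ∀ x y z : Plane, f x ≤ c → f y ≤ c → z ∈ segment ℝ x y → f z ≤ c :=
    fun x y z hx hy hz =>
      (convex_halfSpace_le f.toLinearMap.isLinear c).segment_subset hx hy hz
  have hA₁ : a₁ ∈ C \ E := ⟨ha₁.1.1, ha₁.2⟩
  have hA₂ : a₂ ∈ C \ E := ⟨ha₂.1.1, ha₂.2⟩
  have key : ∀ b₁ ∈ E, ∀ b₂ ∈ E, b₁ ∈ C → f b₁ ≤ c → b₂ ∉ C → q ∈ segment ℝ b₁ b₂ →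
      ((∀ x ∈ E, f x ≤ c → x ∈ C) ∧ ∃ x ∈ E, x ∈ C ∧ f x ≤ c) := by
    intro b₁ hb₁ b₂ hb₂ hb₁C hfb₁ hb₂C hq
    refine ⟨fun p hp hfp => ?_, b₁, hb₁, hb₁C, hfb₁⟩
    by_contra hpC
    obtain ⟨z, hz, hz1 | hz2⟩ :=
      exists_mem_segment_of_crossing hE ha₁.2 ha₂.2 hb₁ hb₂ hp hqa hq
    · exact absurd (hgt z hz) (not_lt.2 (hle _ _ z hfb₁ hfp hz1))
    · exact h _ hA₁ _ hA₂ _ ⟨hb₂, hb₂C⟩ _ ⟨hp, hpC⟩ z hz hz2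
  have hfC : ∀ b, b ∉ C ∩ {x | c < f x} → b ∈ C → f b ≤ c := fun b hb hbC =>
    not_lt.1 fun hlt => hb ⟨hbC, hlt⟩
  by_cases h1 : b₁ ∈ C <;> by_cases h2 : b₂ ∈ C
  · exact absurd (hgt q hqa) (not_lt.2 (hle _ _ q (hfC _ hb₁.2 h1) (hfC _ hb₂.2 h2) hqb))
  · exact key b₁ hb₁.1 b₂ hb₂.1 h1 (hfC _ hb₁.2 h1) h2 hqb
  · exact key b₂ hb₂.1 b₁ hb₁.1 h2 (hfC _ hb₂.2 h2) h1 (segment_symm ℝ b₁ b₂ ▸ hqb)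
  · exact absurd hqb (h _ hA₁ _ hA₂ _ ⟨hb₁.1, h1⟩ _ ⟨hb₂.1, h2⟩ q hqa)

theorem exists_lt_of_mem_isOpen {o : Set Plane} (ho : IsOpen o) {x : Plane} (hx : x ∈ o)
    {f : Plane →L[ℝ] ℝ} (hf : f ≠ 0) : ∃ y ∈ o, f y < f x := by
  obtain ⟨v, hv⟩ : ∃ v, f v ≠ 0 := by
    by_contra! hcon
    exact hf (ContinuousLinearMap.ext hcon)
  have hcont : Continuous fun t : ℝ => x - (t * f v) • v := by fun_prop
  have hmem : ∀ᶠ t in nhdsWithin (0 : ℝ) (Set.Ioi 0), x - (t * f v) • v ∈ o := by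
    refine (hcont.tendsto' 0 x (by simp)).eventually (ho.mem_nhds hx) |>.filter_mono
      nhdsWithin_le_nhds
  obtain ⟨t, hto, ht⟩ := (hmem.and self_mem_nhdsWithin).exists
  refine ⟨_, hto, ?_⟩
  have ht' : 0 < t := ht
  simp only [map_sub, map_smul, smul_eq_mul]
  have := mul_pos ht' (mul_self_pos.2 hv)
  nlinarith

theorem dense_inter_ne {o : Set Plane} (ho : IsOpen o) (hd : Dense o) {f : Plane →L[ℝ] ℝ} {c : ℝ}
    (hfc : f ≠ 0 ∨ c ≠ 0) : Dense (o ∩ {x | f x ≠ c}) := by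
  rcases eq_or_ne f 0 with rfl | hf
  · have hc : c ≠ 0 := by simpa using hfc
    convert hd using 1
    ext x
    simpa using fun _ => hc.symm
  rw [dense_iff_inter_open]
  intro u hu hne
  obtain ⟨x, hxu, hxo⟩ := hd.inter_open_nonempty u hu hne
  by_cases hx : f x = c
  · obtain ⟨y, hy, hlt⟩ := exists_lt_of_mem_isOpen (hu.inter ho) ⟨hxu, hxo⟩ hf
    exact ⟨y, hy.1, hy.2, (hx ▸ hlt).ne⟩
  · exact ⟨x, hxu, hxo, hx⟩

/-- The members other than `d` that meet `U d` exactly in `L` and whose part in the halfplane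
`f < c` lies in `U d`. -/
def cutIndices {ι : Type*} (U : ι → Set Plane) (d : ι) (L : Set Plane) (f : Plane →L[ℝ] ℝ)
    (c : ℝ) : Set ι :=
  {i | i ≠ d ∧ U i ∩ U d = L ∧ ∀ x ∈ U i, f x < c → x ∈ U d}

theorem noncrossing_cut {ι : Type*} {U : ι → Set Plane} (ho : ∀ i, IsOpen (U i))
    (hc : ∀ i, Convex ℝ (U i)) (hn : ∀ i j, Noncrossing (U i) (U j)) {d : ι} {L : Set Plane}
    {f : Plane →L[ℝ] ℝ} {c : ℝ} (hfc : f ≠ 0 ∨ c ≠ 0)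
    (hmin : ∀ j, j ≠ d → (U j ∩ U d).Nonempty → U j ∩ U d ⊆ L → U j ∩ U d = L)
    (hsep : ∀ x ∈ U d, x ∉ L → f x ≤ c) {i j : ι} (hi : i ∈ cutIndices U d L f c)
    (hj : j ∉ cutIndices U d L f c) (hjd : j ≠ d) :
    Noncrossing (U i ∩ {x | c < f x}) (U j) := by
  refine ((hn i j).cut_or_subset (hc j) f c).resolve_right ?_
  rintro ⟨h1, x₀, hx₀j, hx₀i, hfx₀⟩
  refine hj ⟨hjd, hmin j hjd ?_ ?_, fun x hx hfx => hi.2.2 x (h1 x hx hfx.le) hfx⟩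
  · rcases hfx₀.lt_or_eq with hlt | heq
    · exact ⟨x₀, hx₀j, hi.2.2 x₀ hx₀i hlt⟩
    have hf : f ≠ 0 := by
      rintro rfl
      simp at hfc heq
      exact hfc heq.symm
    obtain ⟨y, hy, hlt⟩ := exists_lt_of_mem_isOpen ((ho i).inter (ho j)) ⟨hx₀i, hx₀j⟩ hf
    exact ⟨y, hy.2, hi.2.2 y hy.1 (heq ▸ hlt)⟩
  · rintro x ⟨hxj, hxd⟩
    by_contra hxL
    refine hxL ?_
    rw [← hi.2.1]
    exact ⟨h1 x hxj (hsep x hxd hxL), hxd⟩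

theorem noncrossing_cut_cut {ι : Type*} {U : ι → Set Plane} (ho : ∀ i, IsOpen (U i))
    (hc : ∀ i, Convex ℝ (U i)) (hn : ∀ i j, Noncrossing (U i) (U j)) {d : ι} {L : Set Plane}
    {f : Plane →L[ℝ] ℝ} {c : ℝ} (hfc : f ≠ 0 ∨ c ≠ 0)
    (hmin : ∀ j, j ≠ d → (U j ∩ U d).Nonempty → U j ∩ U d ⊆ L → U j ∩ U d = L)
    (hsep : ∀ x ∈ U d, x ∉ L → f x ≤ c) {i j : ι} (hid : i ≠ d) (hjd : j ≠ d) :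
    Noncrossing (U i ∩ {x | i ∈ cutIndices U d L f c → c < f x})
      (U j ∩ {x | j ∈ cutIndices U d L f c → c < f x}) := by
  by_cases hi : i ∈ cutIndices U d L f c <;> by_cases hj : j ∈ cutIndices U d L f c
  · simp only [hi, hj, forall_const]
    have hmem : ∀ s t : Set Plane, ∀ x ∈ (s ∩ {x | c < f x}) \ (t ∩ {x | c < f x}), x ∈ s \ t :=
      fun s t x hx => ⟨hx.1.1, fun hxt => hx.2 ⟨hxt, hx.1.2⟩⟩
    exact fun a₁ ha₁ a₂ ha₂ b₁ hb₁ b₂ hb₂ => hn i j a₁ (hmem _ _ _ ha₁) a₂ (hmem _ _ _ ha₂)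
      b₁ (hmem _ _ _ hb₁) b₂ (hmem _ _ _ hb₂)
  · simpa [hi, hj] using noncrossing_cut ho hc hn hfc hmin hsep hi hj hjd
  · simpa [hi, hj] using (noncrossing_cut ho hc hn hfc hmin hsep hj hi hid).symm
  · simpa [hi, hj] using hn i j

/-- One uncrossing step: in a finite noncrossing family of open convex sets with dense union, an
overlapping pair can be made disjoint by cutting members along a line. -/
theorem exists_cut {ι : Type*} [Finite ι] {U : ι → Set Plane} (ho : ∀ i, IsOpen (U i))
    (hc : ∀ i, Convex ℝ (U i)) (hn : ∀ i j, Noncrossing (U i) (U j))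
    (hd : Dense (⋃ i, U i)) (hne : ∃ i j, i ≠ j ∧ (U i ∩ U j).Nonempty) :
    ∃ U' : ι → Set Plane, (∀ i, IsOpen (U' i)) ∧ (∀ i, Convex ℝ (U' i)) ∧
      (∀ i j, Noncrossing (U' i) (U' j)) ∧ Dense (⋃ i, U' i) ∧ (∀ i, U' i ⊆ U i) ∧
      ∃ i j, i ≠ j ∧ (U i ∩ U j).Nonempty ∧ ¬ (U' i ∩ U' j).Nonempty := by
  obtain ⟨L, ⟨⟨⟨a, b⟩, ⟨hab, hLne⟩, rfl⟩, hLmin⟩⟩ := Set.Finite.exists_minimal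
    (s := (fun p : ι × ι => U p.1 ∩ U p.2) '' {p | p.1 ≠ p.2 ∧ (U p.1 ∩ U p.2).Nonempty})
    (Set.toFinite _) (by
      obtain ⟨i, j, h⟩ := hne
      exact ⟨_, (i, j), h, rfl⟩)
  replace hLmin : ∀ i j, i ≠ j → (U i ∩ U j).Nonempty → U i ∩ U j ⊆ U a ∩ U b →
      U i ∩ U j = U a ∩ U b := fun i j hij h hsub =>
    subset_antisymm hsub (hLmin (y := U i ∩ U j) ⟨(i, j), ⟨hij, h⟩, rfl⟩ hsub)
  obtain ⟨f, k, hfk, hk₁, hk₂⟩ :=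
    exists_separating_of_noncrossing (hc a) (hc b) (ho a) (ho b) (hn a b)
  set S₁ := cutIndices U b (U a ∩ U b) f k with hS₁
  set S₂ := cutIndices U a (U a ∩ U b) (-f) (-k) with hS₂
  have ha₁ : a ∈ S₁ := ⟨hab, rfl, fun x hx hlt => by
    by_contra hxb
    exact absurd (hk₁ x ⟨hx, hxb⟩) (not_le.2 hlt)⟩
  have hb₂ : b ∈ S₂ := ⟨hab.symm, Set.inter_comm _ _, fun x hx hlt => by
    by_contra hxa
    have := hk₂ x ⟨hx, hxa⟩
    simp at hlt
    linarith⟩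
  have hb₁ : b ∉ S₁ := fun h => h.1 rfl
  have ha₂ : a ∉ S₂ := fun h => h.1 rfl
  have hmem₂ : ∀ x, -k < (-f) x ↔ f x < k := by intro x; simp
  set U' : ι → Set Plane := fun i =>
    U i ∩ {x | i ∈ S₁ → k < f x} ∩ {x | i ∈ S₂ → -k < (-f) x} with hU'
  have hsub : ∀ i, U' i ⊆ U i := fun i x hx => hx.1.1
  have hconv : ∀ i, Convex ℝ (U' i) := by
    intro i
    refine ((hc i).inter ?_).inter ?_
    · by_cases hi : i ∈ S₁
      · simpa [hi] using convex_halfSpace_gt f.toLinearMap.isLinear k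
      · simpa [hi] using convex_univ
    · by_cases hi : i ∈ S₂
      · simp only [hi, forall_const]
        exact convex_halfSpace_gt (-f).toLinearMap.isLinear (-k)
      · simpa [hi] using convex_univ
  refine ⟨U', fun i => ?_, hconv, fun i j => ?_, ?_, hsub, a, b, hab, hLne, ?_⟩
  · refine ((ho i).inter ?_).inter ?_
    · by_cases hi : i ∈ S₁
      · simpa [hi] using isOpen_lt continuous_const f.continuous
      · simp [hi]
    · by_cases hi : i ∈ S₂
      · simpa only [hi, forall_const] using isOpen_lt continuous_const (-f).continuous
      · simp [hi]
  · by_cases h₁ : i ∉ S₁ ∧ j ∉ S₁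
    · have := noncrossing_cut_cut ho hc hn (d := a) (L := U a ∩ U b) (f := -f) (c := -k)
        (i := i) (j := j) (by simpa using hfk) (fun j hj h1 h2 => hLmin j a hj h1 h2)
        (fun x hx hxL => by simpa using hk₁ x ⟨hx, fun hxb => hxL ⟨hx, hxb⟩⟩)
        (fun h => h₁.1 (h ▸ ha₁)) (fun h => h₁.2 (h ▸ ha₁))
      simp only [hU', h₁, IsEmpty.forall_iff, Set.ofPred_true, Set.inter_univ]
      exact this
    by_cases h₂ : i ∉ S₂ ∧ j ∉ S₂
    · have := noncrossing_cut_cut ho hc hn (d := b) (L := U a ∩ U b) (f := f) (c := k)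
        (i := i) (j := j) hfk (fun j hj h1 h2 => hLmin j b hj h1 h2)
        (fun x hx hxL => hk₂ x ⟨hx, fun hxa => hxL ⟨hxa, hx⟩⟩)
        (fun h => h₂.1 (h ▸ hb₂)) (fun h => h₂.2 (h ▸ hb₂))
      simp only [hU', h₂, IsEmpty.forall_iff, Set.ofPred_true, Set.inter_univ]
      exact this
    · intro a₁ ha₁ a₂ ha₂ b₁ hb₁ b₂ hb₂ q hqa hqb
      have hqi := (hconv i).segment_subset ha₁.1 ha₂.1 hqa
      have hqj := (hconv j).segment_subset hb₁.1 hb₂.1 hqb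
      have e₁ : k < f q := by
        by_cases hi : i ∈ S₁
        · exact hqi.1.2 hi
        · exact hqj.1.2 (by tauto)
      have e₂ : f q < k := by
        rw [← hmem₂]
        by_cases hi : i ∈ S₂
        · exact hqi.2 hi
        · exact hqj.2 (by tauto)
      exact lt_asymm e₁ e₂
  · refine (dense_inter_ne (isOpen_iUnion ho) hd hfk).mono ?_
    rintro x ⟨hx, hxk⟩
    obtain ⟨i, hi⟩ := Set.mem_iUnion.1 hx
    rw [Set.mem_iUnion]
    rcases lt_or_gt_of_ne hxk with hlt | hlt
    · by_cases hi₁ : i ∈ S₁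
      · exact ⟨b, ⟨hi₁.2.2 x hi hlt, fun h => absurd h hb₁⟩, fun _ => (hmem₂ x).2 hlt⟩
      · exact ⟨i, ⟨hi, fun h => absurd h hi₁⟩, fun _ => (hmem₂ x).2 hlt⟩
    · by_cases hi₂ : i ∈ S₂
      · exact ⟨a, ⟨hi₂.2.2 x hi (by simpa using hlt), fun _ => hlt⟩, fun h => absurd h ha₂⟩
      · exact ⟨i, ⟨hi, fun _ => hlt⟩, fun h => absurd h hi₂⟩
  · rintro ⟨x, hxa, hxb⟩
    exact lt_asymm (hxa.1.2 ha₁) ((hmem₂ x).1 (hxb.2 hb₂))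

/-- A finite noncrossing family of open convex sets with dense union can be shrunk to a disjoint
family of open convex sets with dense union. -/
theorem exists_disjoint_refinement {ι : Type*} [Finite ι] {U : ι → Set Plane}
    (ho : ∀ i, IsOpen (U i)) (hc : ∀ i, Convex ℝ (U i)) (hn : ∀ i j, Noncrossing (U i) (U j))
    (hd : Dense (⋃ i, U i)) :
    ∃ W : ι → Set Plane, (∀ i, IsOpen (W i)) ∧ (∀ i, Convex ℝ (W i)) ∧ (∀ i, W i ⊆ U i) ∧
      Pairwise (fun i j => Disjoint (W i) (W j)) ∧ Dense (⋃ i, W i) := by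
  induction hN : Set.ncard {p : ι × ι | p.1 ≠ p.2 ∧ (U p.1 ∩ U p.2).Nonempty}
    using Nat.strong_induction_on generalizing U with
  | _ N ih =>
  by_cases hne : ∃ i j, i ≠ j ∧ (U i ∩ U j).Nonempty
  · obtain ⟨U', ho', hc', hn', hd', hsub, i, j, hij, h1, h2⟩ := exists_cut ho hc hn hd hne
    obtain ⟨W, hWo, hWc, hWU, hW⟩ := ih _ (hN ▸ Set.ncard_lt_ncard
      (s := {p : ι × ι | p.1 ≠ p.2 ∧ (U' p.1 ∩ U' p.2).Nonempty})
      ⟨fun p hp => ⟨hp.1, hp.2.mono (Set.inter_subset_inter (hsub _) (hsub _))⟩,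
        fun h => h2 (h (a := (i, j)) ⟨hij, h1⟩).2⟩ (Set.toFinite _)) ho' hc' hn' hd' rfl
    exact ⟨W, hWo, hWc, fun i => (hWU i).trans (hsub i), hW⟩
  · refine ⟨U, ho, hc, fun _ => subset_rfl, fun i j hij => ?_, hd⟩
    show Disjoint (U i) (U j)
    rw [Set.disjoint_iff_inter_eq_empty, ← Set.not_nonempty_iff_eq_empty]
    exact fun h => hne ⟨i, j, hij, h⟩

/-- The interiors of two convex pseudo-disks are noncrossing. -/
theorem noncrossing_interior {C D : Set Plane} (hC : Convex ℝ C) (hD : Convex ℝ D)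
    (h : IsPreconnected (C \ D)) : Noncrossing (interior C) (interior D) := by
  intro a₁ ha₁ a₂ ha₂ b₁ hb₁ b₂ hb₂ q hqa hqb
  have hqC : q ∈ interior C := hC.interior.segment_subset ha₁.1 ha₂.1 hqa
  have hbD : segment ℝ b₁ b₂ ⊆ interior D := hD.interior.segment_subset hb₁.1 hb₂.1
  set g : Plane → ℝ := fun x =>
    (b₂ 0 - b₁ 0) * (x 1 - b₁ 1) - (b₂ 1 - b₁ 1) * (x 0 - b₁ 0) with hgdef
  have hg : ∀ x y : Plane, ∀ a b : ℝ, a + b = 1 →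
      g (a • x + b • y) = a * g x + b * g y := by
    intro x y a b hab
    obtain rfl : b = 1 - a := by linarith
    simp only [hgdef, Pi.add_apply, Pi.smul_apply, smul_eq_mul]
    ring
  have hgc : Continuous g := by fun_prop
  have hline : ∀ x ∈ C, g x = 0 → x ∈ interior D := by
    intro x hx hgx
    obtain ⟨τ, rfl⟩ : ∃ τ : ℝ, x = b₁ + τ • (b₂ - b₁) := by
      simp only [hgdef] at hgx
      by_cases h0 : b₂ 0 - b₁ 0 = 0
      · by_cases h1 : b₂ 1 - b₁ 1 = 0
        · exfalso
          have : b₂ = b₁ := by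
            ext i; fin_cases i
            · exact sub_eq_zero.1 h0
            · exact sub_eq_zero.1 h1
          rw [this, segment_same] at hqb
          rw [Set.mem_singleton_iff.1 hqb] at hqC
          exact hb₁.2 hqC
        · refine ⟨(x 1 - b₁ 1) / (b₂ 1 - b₁ 1), ?_⟩
          have hz0 : x 0 - b₁ 0 = 0 := by
            rw [h0] at hgx
            have : (b₂ 1 - b₁ 1) * (x 0 - b₁ 0) = 0 := by linarith
            exact (mul_eq_zero.1 this).resolve_left h1
          ext i; fin_cases i
          · simp [h0]; linarith
          · simp; field_simp; ring
      · refine ⟨(x 0 - b₁ 0) / (b₂ 0 - b₁ 0), ?_⟩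
        ext i; fin_cases i
        · simp; field_simp; ring
        · simp; field_simp; linarith
    rw [segment_eq_image'] at hbD hqb
    obtain ⟨σ, hσ, hσq⟩ := hqb
    refine hbD ⟨τ, ⟨?_, ?_⟩, rfl⟩
    · by_contra! hneg
      have hσ0 : 0 < σ := hσ.1.lt_of_ne fun h0 => hb₁.2 <| by
        rw [← h0] at hσq
        simpa [← hσq] using hqC
      have hpos : 0 < σ - τ := by linarith
      refine hb₁.2 ?_
      convert hC.combo_interior_self_mem_interior hqC hx (a := -τ / (σ - τ)) (b := σ / (σ - τ))
        (div_pos (by linarith) hpos) (div_nonneg hσ.1 hpos.le) (by field_simp; ring) using 1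
      rw [← hσq]
      ext i
      simp
      field_simp
      ring
    · by_contra! hneg
      have hpos : 0 < τ - σ := by linarith [hσ.2]
      refine hb₂.2 ?_
      convert hC.combo_interior_self_mem_interior hqC hx (a := (τ - 1) / (τ - σ))
        (b := (1 - σ) / (τ - σ)) (div_pos (by linarith) hpos)
        (div_nonneg (by linarith [hσ.2]) hpos.le) (by field_simp; ring) using 1
      rw [← hσq]
      ext i
      simp
      field_simp
      ring
  have hgq : g q = 0 := by
    obtain ⟨a, b, _, _, hab, rfl⟩ := hqb
    rw [hg _ _ _ _ hab]
    simp only [hgdef]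
    ring
  have key : ∀ x ∈ interior C \ interior D, ∀ y ∈ interior C \ interior D,
      g x < 0 → 0 < g y → False := by
    intro x hx y hy hgx hgy
    have hcl : ∀ z ∈ interior C \ interior D, z ∈ closure Dᶜ := by
      rintro z ⟨_, hz⟩
      rwa [closure_compl]
    obtain ⟨x', ⟨hx'C, hx'g⟩, hx'D⟩ := mem_closure_iff.1 (hcl x hx)
      (interior C ∩ {z | g z < 0}) (isOpen_interior.inter (isOpen_lt hgc continuous_const))
      ⟨hx.1, hgx⟩
    obtain ⟨y', ⟨hy'C, hy'g⟩, hy'D⟩ := mem_closure_iff.1 (hcl y hy)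
      (interior C ∩ {z | 0 < g z}) (isOpen_interior.inter (isOpen_lt continuous_const hgc))
      ⟨hy.1, hgy⟩
    obtain ⟨z, hz, hz0⟩ := h.intermediate_value (f := g) ⟨interior_subset hx'C, hx'D⟩
      ⟨interior_subset hy'C, hy'D⟩ hgc.continuousOn ⟨le_of_lt hx'g, le_of_lt hy'g⟩
    exact hz.2 (interior_subset (hline z hz.1 hz0))
  have hne : ∀ x ∈ interior C \ interior D, g x ≠ 0 := fun x hx h0 =>
    hx.2 (hline x (interior_subset hx.1) h0)
  obtain ⟨a, b, ha, hb, hab, rfl⟩ := hqa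
  rw [hg _ _ _ _ hab] at hgq
  rcases lt_or_gt_of_ne (hne a₁ ha₁) with h1 | h1 <;>
    rcases lt_or_gt_of_ne (hne a₂ ha₂) with h2 | h2
  · have := convex_Iio (0 : ℝ) h1 h2 ha hb hab
    exact this.ne hgq
  · exact key _ ha₁ _ ha₂ h1 h2
  · exact key _ ha₂ _ ha₁ h2 h1
  · have := convex_Ioi (0 : ℝ) h1 h2 ha hb hab
    exact this.ne' hgq

/-- A finite cover of the plane by convex pseudo-disks can be shrunk to a disjoint family of open
convex sets with dense union. -/
theorem IsPseudoDiskFamily.exists_disjoint_refinement {𝒟 : Finset (Set Plane)}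
    (h𝒟 : IsPseudoDiskFamily 𝒟) (hcov : ⋃₀ (𝒟 : Set (Set Plane)) = Set.univ) :
    ∃ W : 𝒟 → Set Plane, (∀ i, IsOpen (W i)) ∧ (∀ i, Convex ℝ (W i)) ∧ (∀ i, W i ⊆ i) ∧
      Pairwise (fun i j => Disjoint (W i) (W j)) ∧ Dense (⋃ i, W i) := by
  obtain ⟨W, hWo, hWc, hWU, hW⟩ := _root_.exists_disjoint_refinement
    (U := fun i : 𝒟 => interior (i : Set Plane)) (fun i => isOpen_interior)
    (fun i => (h𝒟.1 i i.2).1.interior)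
    (fun i j => noncrossing_interior (h𝒟.1 i i.2).1 (h𝒟.1 j j.2).1 (h𝒟.2 i i.2 j j.2))
    (dense_iUnion_interior_of_closed (fun i => (h𝒟.1 i i.2).2)
      (by rw [← hcov, Set.sUnion_eq_iUnion]; rfl))
  exact ⟨W, hWo, hWc, fun i => (hWU i).trans interior_subset, hW⟩

/-- The affine function `c.1 * x + c.2.1 * y + c.2.2`. -/
def aff (c : ℝ × ℝ × ℝ) (p : ℝ × ℝ) : ℝ := c.1 * p.1 + c.2.1 * p.2 + c.2.2

/-- The linear part of `aff c` is nonzero. -/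
def NonconstAff (c : ℝ × ℝ × ℝ) : Prop := c.1 ≠ 0 ∨ c.2.1 ≠ 0

theorem continuous_aff (c : ℝ × ℝ × ℝ) : Continuous (aff c) := by
  unfold aff
  fun_prop

theorem isOpen_aff_pos (c : ℝ × ℝ × ℝ) : IsOpen {p | 0 < aff c p} :=
  isOpen_lt continuous_const (continuous_aff c)

theorem isClosed_aff_nonneg (c : ℝ × ℝ × ℝ) : IsClosed {p | 0 ≤ aff c p} :=
  isClosed_le continuous_const (continuous_aff c)

theorem aff_combo (c : ℝ × ℝ × ℝ) (p q : ℝ × ℝ) {a b : ℝ} (hab : a + b = 1) :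
    aff c (a • p + b • q) = a * aff c p + b * aff c q := by
  obtain rfl : b = 1 - a := by linarith
  simp only [aff, Prod.fst_add, Prod.snd_add, Prod.smul_fst, Prod.smul_snd, smul_eq_mul]
  ring

theorem convex_aff_pos (c : ℝ × ℝ × ℝ) : Convex ℝ {p | 0 < aff c p} := by
  intro p hp q hq a b ha hb hab
  simp only [Set.mem_ofPred_eq] at hp hq ⊢
  rw [aff_combo c p q hab]
  exact convex_Ioi (0 : ℝ) hp hq ha hb hab

/-- An intersection of three closed halfplanes, in the coordinates `ℝ × ℝ`. -/
def IsTri (Δ : Set (ℝ × ℝ)) : Prop :=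
  ∃ c₁ c₂ c₃ : ℝ × ℝ × ℝ, NonconstAff c₁ ∧ NonconstAff c₂ ∧ NonconstAff c₃ ∧
    Δ = {p | 0 ≤ aff c₁ p ∧ 0 ≤ aff c₂ p ∧ 0 ≤ aff c₃ p}

theorem IsTri.isClosed {Δ : Set (ℝ × ℝ)} (h : IsTri Δ) : IsClosed Δ := by
  obtain ⟨c₁, c₂, c₃, -, -, -, rfl⟩ := h
  exact (isClosed_aff_nonneg c₁).inter ((isClosed_aff_nonneg c₂).inter (isClosed_aff_nonneg c₃))

/-- `A` can be tiled, up to its boundary, by at most `N` triangles. -/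
def HasTiling (A : Set (ℝ × ℝ)) (N : ℕ) : Prop :=
  ∃ T : Finset (Set (ℝ × ℝ)), T.card ≤ N ∧ (∀ Δ ∈ T, IsTri Δ ∧ Δ ⊆ closure A) ∧
    (∀ Δ₁ ∈ T, ∀ Δ₂ ∈ T, Δ₁ ≠ Δ₂ → interior Δ₁ ∩ interior Δ₂ = ∅) ∧ A ⊆ ⋃₀ T

theorem hasTiling_empty (N : ℕ) : HasTiling ∅ N :=
  ⟨∅, by simp, by simp, by simp, by simp⟩

theorem HasTiling.mono {A : Set (ℝ × ℝ)} {M N : ℕ} (h : HasTiling A M) (hMN : M ≤ N) :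
    HasTiling A N := by
  obtain ⟨T, hT, h⟩ := h
  exact ⟨T, hT.trans hMN, h⟩

theorem IsOpen.interior_closure_subset_of_convex {A : Set (ℝ × ℝ)} (ho : IsOpen A)
    (hc : Convex ℝ A) : interior (closure A) ⊆ A := by
  rcases A.eq_empty_or_nonempty with rfl | hne
  · simp
  · rw [hc.interior_closure_eq_interior_of_nonempty_interior (by rwa [ho.interior_eq]),
      ho.interior_eq]

theorem exists_tiling_iUnion {κ : Type*} [Fintype κ] {A : κ → Set (ℝ × ℝ)} {N : κ → ℕ}
    (ho : ∀ k, IsOpen (A k)) (hc : ∀ k, Convex ℝ (A k))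
    (hd : Pairwise fun k l => Disjoint (A k) (A l)) (h : ∀ k, HasTiling (A k) (N k)) :
    ∃ T : Finset (Set (ℝ × ℝ)), T.card ≤ ∑ k, N k ∧
      (∀ Δ ∈ T, IsTri Δ ∧ ∃ k, Δ ⊆ closure (A k)) ∧
      (∀ Δ₁ ∈ T, ∀ Δ₂ ∈ T, Δ₁ ≠ Δ₂ → interior Δ₁ ∩ interior Δ₂ = ∅) ∧
      closure (⋃ k, A k) ⊆ ⋃₀ T := by
  choose T hT₁ hT₂ hT₃ hT₄ using h
  have hmem : ∀ Δ, Δ ∈ Finset.univ.biUnion T ↔ ∃ k, Δ ∈ T k := by simp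
  have htri : ∀ Δ ∈ Finset.univ.biUnion T, IsTri Δ ∧ ∃ k, Δ ⊆ closure (A k) := by
    intro Δ hΔ
    obtain ⟨k, hk⟩ := (hmem Δ).1 hΔ
    exact ⟨(hT₂ k Δ hk).1, k, (hT₂ k Δ hk).2⟩
  refine ⟨Finset.univ.biUnion T, Finset.card_biUnion_le.trans (Finset.sum_le_sum fun k _ => hT₁ k),
    htri, fun Δ₁ h₁ Δ₂ h₂ hne => ?_, ?_⟩
  · obtain ⟨k, hk⟩ := (hmem Δ₁).1 h₁
    obtain ⟨l, hl⟩ := (hmem Δ₂).1 h₂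
    rcases eq_or_ne k l with rfl | hkl
    · exact hT₃ k Δ₁ hk Δ₂ hl hne
    · rw [← Set.disjoint_iff_inter_eq_empty]
      have hsub : ∀ k, ∀ Δ ∈ T k, interior Δ ⊆ A k := fun k Δ hΔ =>
        (interior_mono (hT₂ k Δ hΔ).2).trans ((ho k).interior_closure_subset_of_convex (hc k))
      exact (hd hkl).mono (hsub k Δ₁ hk) (hsub l Δ₂ hl)
  · refine closure_minimal (Set.iUnion_subset fun k x hx => ?_) ?_
    · obtain ⟨Δ, hΔ, hxΔ⟩ := hT₄ k hx
      exact ⟨Δ, Finset.mem_coe.2 ((hmem Δ).2 ⟨k, hΔ⟩), hxΔ⟩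
    · rw [Set.sUnion_eq_biUnion]
      exact (Finset.finite_toSet _).isClosed_biUnion fun Δ hΔ =>
        (htri Δ (Finset.mem_coe.1 hΔ)).1.isClosed

theorem HasTiling.of_split {A A₁ A₂ : Set (ℝ × ℝ)} {M N : ℕ} (h₁ : HasTiling A₁ M)
    (h₂ : HasTiling A₂ N) (ho₁ : IsOpen A₁) (ho₂ : IsOpen A₂) (hc₁ : Convex ℝ A₁)
    (hc₂ : Convex ℝ A₂) (hd : Disjoint A₁ A₂) (hs₁ : A₁ ⊆ A) (hs₂ : A₂ ⊆ A)
    (hcov : A ⊆ closure (A₁ ∪ A₂)) : HasTiling A (M + N) := by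
  obtain ⟨T, hT₁, hT₂, hT₃, hT₄⟩ := exists_tiling_iUnion (κ := Bool)
    (A := fun b => cond b A₁ A₂) (N := fun b => cond b M N)
    (by rintro (_ | _) <;> assumption) (by rintro (_ | _) <;> assumption)
    (by rintro (_ | _) (_ | _) h <;> first | exact absurd rfl h | exact hd | exact hd.symm)
    (by rintro (_ | _) <;> assumption)
  refine ⟨T, by simpa using hT₁, fun Δ hΔ => ⟨(hT₂ Δ hΔ).1, ?_⟩, hT₃, ?_⟩
  · obtain ⟨_ | _, hk⟩ := (hT₂ Δ hΔ).2
    · exact hk.trans (closure_mono hs₂)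
    · exact hk.trans (closure_mono hs₁)
  · refine (hcov.trans (closure_mono ?_)).trans hT₄
    exact Set.union_subset (Set.subset_iUnion (fun b => cond b A₁ A₂) true)
      (Set.subset_iUnion (fun b => cond b A₁ A₂) false)

theorem subset_closure_of_aff_ne {A B : Set (ℝ × ℝ)} (hA : IsOpen A) {c : ℝ × ℝ × ℝ}
    (hc : NonconstAff c) (h : ∀ p ∈ A, aff c p ≠ 0 → p ∈ B) : A ⊆ closure B := by
  intro p hp
  by_cases hp0 : aff c p = 0
  · have hcont : Continuous fun ε : ℝ => (p.1 + ε * c.1, p.2 + ε * c.2.1) := by fun_prop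
    have htend : Filter.Tendsto (fun ε : ℝ => (p.1 + ε * c.1, p.2 + ε * c.2.1))
        (nhdsWithin 0 (Set.Ioi 0)) (nhds p) :=
      (hcont.tendsto' 0 p (by simp)).mono_left nhdsWithin_le_nhds
    refine mem_closure_of_tendsto htend ?_
    filter_upwards [htend.eventually (hA.mem_nhds hp), self_mem_nhdsWithin] with ε hε hε0
    refine h _ hε ?_
    have hpos : 0 < c.1 ^ 2 + c.2.1 ^ 2 := by
      rcases hc with hc | hc <;> positivity
    have hval : aff c (p.1 + ε * c.1, p.2 + ε * c.2.1) = ε * (c.1 ^ 2 + c.2.1 ^ 2) := by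
      simp only [aff] at hp0 ⊢
      linear_combination hp0
    rw [hval]
    exact (mul_pos hε0 hpos).ne'
  · exact subset_closure (h p hp hp0)

/-- The intersection of three open halfplanes, one of which may not be trivial. -/
theorem hasTiling_three (c₁ c₂ c₃ : ℝ × ℝ × ℝ)
    (hc : NonconstAff c₁ ∨ NonconstAff c₂ ∨ NonconstAff c₃) :
    HasTiling {p | 0 < aff c₁ p ∧ 0 < aff c₂ p ∧ 0 < aff c₃ p} 1 := by
  rcases Set.eq_empty_or_nonempty {p | 0 < aff c₁ p ∧ 0 < aff c₂ p ∧ 0 < aff c₃ p} with he | ⟨q, hq⟩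
  · rw [he]
    exact hasTiling_empty 1
  obtain ⟨c₀, hc₀, hc₀q⟩ : ∃ c₀, NonconstAff c₀ ∧
      ∀ p, 0 < aff c₁ p ∧ 0 < aff c₂ p ∧ 0 < aff c₃ p → 0 < aff c₀ p := by
    rcases hc with h | h | h
    · exact ⟨c₁, h, fun p hp => hp.1⟩
    · exact ⟨c₂, h, fun p hp => hp.2.1⟩
    · exact ⟨c₃, h, fun p hp => hp.2.2⟩
  have hrep : ∀ c, 0 < aff c q → ∃ c', NonconstAff c' ∧ (0 < aff c' q) ∧
      ((∀ p, aff c' p = aff c p) ∨ (c' = c₀ ∧ ∀ p, 0 < aff c p)) := by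
    intro c hcq
    by_cases h : NonconstAff c
    · exact ⟨c, h, hcq, Or.inl fun _ => rfl⟩
    · refine ⟨c₀, hc₀, hc₀q q hq, Or.inr ⟨rfl, fun p => ?_⟩⟩
      unfold NonconstAff at h
      push Not at h
      simpa [aff, h.1, h.2] using hcq
  obtain ⟨d₁, hd₁, hq₁, h₁⟩ := hrep c₁ hq.1
  obtain ⟨d₂, hd₂, hq₂, h₂⟩ := hrep c₂ hq.2.1
  obtain ⟨d₃, hd₃, hq₃, h₃⟩ := hrep c₃ hq.2.2
  have hnew : ∀ c d p, ((∀ p, aff d p = aff c p) ∨ (d = c₀ ∧ ∀ p, 0 < aff c p)) →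
      0 < aff d p → 0 < aff c p := by
    rintro c d p (h | ⟨-, h⟩) hd
    · rwa [← h]
    · exact h p
  have hold : ∀ c d p, ((∀ p, aff d p = aff c p) ∨ (d = c₀ ∧ ∀ p, 0 < aff c p)) →
      0 < aff c p → (0 < aff c₁ p ∧ 0 < aff c₂ p ∧ 0 < aff c₃ p) → 0 ≤ aff d p := by
    rintro c d p (h | ⟨rfl, h⟩) hd hp
    · rw [h]; exact hd.le
    · exact (hc₀q p hp).le
  refine ⟨{{p | 0 ≤ aff d₁ p ∧ 0 ≤ aff d₂ p ∧ 0 ≤ aff d₃ p}}, by simp, ?_, ?_, ?_⟩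
  · intro Δ hΔ
    rw [Finset.mem_singleton] at hΔ
    subst hΔ
    refine ⟨⟨d₁, d₂, d₃, hd₁, hd₂, hd₃, rfl⟩, fun p hp => ?_⟩
    have hcont : Continuous fun ε : ℝ => (1 - ε) • p + ε • q := by fun_prop
    refine mem_closure_of_tendsto (b := nhdsWithin (0 : ℝ) (Set.Ioi 0))
      ((hcont.tendsto' 0 p (by simp)).mono_left nhdsWithin_le_nhds) ?_
    filter_upwards [self_mem_nhdsWithin, nhdsWithin_le_nhds (Iio_mem_nhds one_pos)] with ε h0 h1
    have hcombo : ∀ d, 0 ≤ aff d p → 0 < aff d q → 0 < aff d ((1 - ε) • p + ε • q) := by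
      intro d hp hq
      rw [aff_combo d p q (by ring)]
      have h2 : 0 < 1 - ε := sub_pos.2 h1
      have h3 : 0 < ε := h0
      positivity
    exact ⟨hnew _ _ _ h₁ (hcombo _ hp.1 hq₁), hnew _ _ _ h₂ (hcombo _ hp.2.1 hq₂),
      hnew _ _ _ h₃ (hcombo _ hp.2.2 hq₃)⟩
  · intro Δ₁ h₁ Δ₂ h₂ hne
    rw [Finset.mem_singleton] at h₁ h₂
    exact absurd (h₁.trans h₂.symm) hne
  · intro p hp
    simp only [Finset.coe_singleton, Set.sUnion_singleton]
    exact ⟨hold _ _ _ h₁ hp.1 hp, hold _ _ _ h₂ hp.2.1 hp, hold _ _ _ h₃ hp.2.2 hp⟩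

theorem isOpen_aff_pos_three (c₁ c₂ c₃ : ℝ × ℝ × ℝ) :
    IsOpen {p | 0 < aff c₁ p ∧ 0 < aff c₂ p ∧ 0 < aff c₃ p} :=
  (isOpen_aff_pos c₁).inter ((isOpen_aff_pos c₂).inter (isOpen_aff_pos c₃))

theorem convex_aff_pos_three (c₁ c₂ c₃ : ℝ × ℝ × ℝ) :
    Convex ℝ {p | 0 < aff c₁ p ∧ 0 < aff c₂ p ∧ 0 < aff c₃ p} :=
  (convex_aff_pos c₁).inter ((convex_aff_pos c₂).inter (convex_aff_pos c₃))

theorem hasTiling_univ : HasTiling Set.univ 2 := by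
  refine HasTiling.of_split
    (hasTiling_three (1, 0, 0) (1, 0, 0) (1, 0, 0) (Or.inl (Or.inl one_ne_zero)))
    (hasTiling_three (-1, 0, 0) (-1, 0, 0) (-1, 0, 0) (Or.inl (Or.inl (by norm_num))))
    (isOpen_aff_pos_three _ _ _) (isOpen_aff_pos_three _ _ _) (convex_aff_pos_three _ _ _)
    (convex_aff_pos_three _ _ _) ?_ (Set.subset_univ _) (Set.subset_univ _)
    (subset_closure_of_aff_ne (c := (1, 0, 0)) isOpen_univ (Or.inl one_ne_zero) ?_)
  · rw [Set.disjoint_left]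
    rintro p ⟨h1, -⟩ ⟨h2, -⟩
    simp only [aff] at h1 h2
    linarith
  · intro p _ hp
    rcases lt_or_gt_of_ne hp with h | h
    · have h' : 0 < aff (-1, 0, 0) p := by simp only [aff] at h ⊢; linarith
      exact Or.inr ⟨h', h', h'⟩
    · exact Or.inl ⟨h, h, h⟩

/-- The region between two lines over a bounded interval. -/
theorem hasTiling_trapezoid (a b m n m' n' : ℝ) :
    HasTiling {p : ℝ × ℝ | a < p.1 ∧ p.1 < b ∧ m * p.1 + n < p.2 ∧ p.2 < m' * p.1 + n'} 2 := by
  set A := {p : ℝ × ℝ | a < p.1 ∧ p.1 < b ∧ m * p.1 + n < p.2 ∧ p.2 < m' * p.1 + n'} with hA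
  have hAo : IsOpen A := by
    simp only [hA, Set.ofPred_and]
    refine IsOpen.inter (isOpen_lt ?_ ?_) (IsOpen.inter (isOpen_lt ?_ ?_)
      (IsOpen.inter (isOpen_lt ?_ ?_) (isOpen_lt ?_ ?_))) <;> fun_prop
  rcases A.eq_empty_or_nonempty with he | ⟨q, hq₁, hq₂, hq₃, hq₄⟩
  · rw [he]
    exact hasTiling_empty 2
  have hab : 0 < b - a := by linarith
  rcases le_or_gt ((m' - m) * a + (n' - n)) 0 with hwa | hwa
  · have := hasTiling_three (-m, 1, -n) (m', -1, n') (-1, 0, b) (Or.inl (Or.inr one_ne_zero))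
    convert this.mono one_le_two using 1
    ext p
    simp only [hA, Set.mem_ofPred_eq, aff]
    refine ⟨fun h => ⟨by linarith [h.2.2.1], by linarith [h.2.2.2], by linarith [h.2.1]⟩,
      fun h => ⟨?_, by linarith [h.2.2], by linarith [h.1], by linarith [h.2.1]⟩⟩
    obtain ⟨h1, h2, h3⟩ := h
    have hm : 0 < m' - m := by
      by_contra! hm
      nlinarith
    by_contra! hle
    nlinarith
  rcases le_or_gt ((m' - m) * b + (n' - n)) 0 with hwb | hwb
  · have := hasTiling_three (-m, 1, -n) (m', -1, n') (1, 0, -a) (Or.inl (Or.inr one_ne_zero))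
    convert this.mono one_le_two using 1
    ext p
    simp only [hA, Set.mem_ofPred_eq, aff]
    refine ⟨fun h => ⟨by linarith [h.2.2.1], by linarith [h.2.2.2], by linarith [h.1]⟩,
      fun h => ⟨by linarith [h.2.2], ?_, by linarith [h.1], by linarith [h.2.1]⟩⟩
    obtain ⟨h1, h2, h3⟩ := h
    have hm : m' - m < 0 := by
      by_contra! hm
      nlinarith
    by_contra! hle
    nlinarith
  set w := (m' - m) * a + (n' - n) with hw
  set d : ℝ × ℝ × ℝ := (w - (b - a) * m, b - a, -(b - a) * n - w * b) with hd
  have hdp : ∀ p : ℝ × ℝ, aff d p = (b - a) * (p.2 - (m * p.1 + n)) - w * (b - p.1) := by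
    intro p
    simp only [hd, aff]
    ring
  set d' : ℝ × ℝ × ℝ := (-d.1, -d.2.1, -d.2.2) with hd'
  have hdp' : ∀ p : ℝ × ℝ, aff d' p = -aff d p := by
    intro p
    simp only [hd', aff]
    ring
  have hwid : ∀ p : ℝ × ℝ, (b - a) * ((m' - m) * p.1 + (n' - n)) =
      w * (b - p.1) + ((m' - m) * b + (n' - n)) * (p.1 - a) := by
    intro p
    rw [hw]
    ring
  refine HasTiling.of_split
    (hasTiling_three (m', -1, n') (-1, 0, b) d (Or.inr (Or.inl (Or.inl (by norm_num)))))
    (hasTiling_three (-m, 1, -n) (1, 0, -a) d' (Or.inl (Or.inr one_ne_zero)))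
    (isOpen_aff_pos_three _ _ _) (isOpen_aff_pos_three _ _ _) (convex_aff_pos_three _ _ _)
    (convex_aff_pos_three _ _ _) ?_ ?_ ?_
    (subset_closure_of_aff_ne (c := d) hAo (Or.inr hab.ne') ?_)
  · rw [Set.disjoint_left]
    rintro p ⟨-, -, h1⟩ ⟨-, -, h2⟩
    rw [hdp'] at h2
    linarith
  · rintro p ⟨h1, h2, h3⟩
    rw [hdp] at h3
    simp only [aff] at h1 h2
    have hpb : 0 < b - p.1 := by linarith
    have h4 : 0 < (b - a) * (p.2 - (m * p.1 + n)) := by nlinarith [mul_pos hwa hpb]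
    have h5 : 0 < p.2 - (m * p.1 + n) := pos_of_mul_pos_right h4 hab.le
    have h6 : 0 < ((m' - m) * b + (n' - n)) * (p.1 - a) := by
      have := mul_pos hab h1
      linarith [hwid p]
    have h7 : 0 < p.1 - a := pos_of_mul_pos_right h6 hwb.le
    exact ⟨by linarith, by linarith, by linarith, by linarith⟩
  · rintro p ⟨h1, h2, h3⟩
    rw [hdp', hdp] at h3
    simp only [aff] at h1 h2
    have h1' : 0 < p.2 - (m * p.1 + n) := by linarith
    have hpa : 0 < p.1 - a := by linarith
    have h4 : 0 < w * (b - p.1) := by nlinarith [mul_pos hab h1']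
    have h5 : 0 < b - p.1 := pos_of_mul_pos_right h4 hwa.le
    have h6 : 0 < (b - a) * (m' * p.1 + n' - p.2) := by
      have := mul_pos hwb hpa
      linarith [hwid p]
    have h7 := pos_of_mul_pos_right h6 hab.le
    exact ⟨by linarith, by linarith, by linarith, by linarith⟩
  · rintro p ⟨h1, h2, h3, h4⟩ hp
    rcases lt_or_gt_of_ne hp with h | h
    · refine Or.inr ⟨?_, ?_, by rw [hdp']; linarith⟩ <;> simp only [aff] <;> linarith
    · refine Or.inl ⟨?_, ?_, h⟩ <;> simp only [aff] <;> linarith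

/-- The function `B i j * (y - (m i j * x + n i j))`, which vanishes on a nonvertical line. -/
def side {ι : Type*} (B m n : ι → ι → ℝ) (i j : ι) (p : ℝ × ℝ) : ℝ :=
  B i j * (p.2 - (m i j * p.1 + n i j))

/-- A family of nonempty open convex cells with dense union, pairwise separated by nonvertical
lines. -/
structure IsCellFamily {ι : Type*} (W : ι → Set (ℝ × ℝ)) (B m n : ι → ι → ℝ) : Prop where
  isOpen : ∀ i, IsOpen (W i)
  convex : ∀ i, Convex ℝ (W i)
  nonempty : ∀ i, (W i).Nonempty
  dense : Dense (⋃ i, W i)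
  pos : ∀ i j, i ≠ j → ∀ p ∈ W i, 0 < side B m n i j p
  neg : ∀ i j, i ≠ j → ∀ p ∈ W j, side B m n i j p < 0

theorem side_combo {ι : Type*} (B m n : ι → ι → ℝ) (i j : ι) (p q : ℝ × ℝ) {a b : ℝ}
    (hab : a + b = 1) :
    side B m n i j (a • p + b • q) = a * side B m n i j p + b * side B m n i j q := by
  obtain rfl : b = 1 - a := by linarith
  simp only [side, Prod.fst_add, Prod.snd_add, Prod.smul_fst, Prod.smul_snd, smul_eq_mul]
  ring

theorem continuous_side {ι : Type*} (B m n : ι → ι → ℝ) (i j : ι) :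
    Continuous (side B m n i j) := by
  unfold side
  fun_prop

/-- `v` is a leftmost or a rightmost point of `A`. -/
def IsLateral (A : Set (ℝ × ℝ)) (v : ℝ × ℝ) : Prop :=
  v ∈ A ∧ ((∀ p ∈ A, v.1 ≤ p.1) ∨ (∀ p ∈ A, p.1 ≤ v.1))

namespace IsCellFamily

variable {ι : Type*} {W : ι → Set (ℝ × ℝ)} {B m n : ι → ι → ℝ}

theorem disjoint (h : IsCellFamily W B m n) {i j : ι} (hij : i ≠ j) : Disjoint (W i) (W j) :=
  Set.disjoint_left.2 fun p hi hj => lt_asymm (h.pos i j hij p hi) (h.neg i j hij p hj)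

theorem nonpos (h : IsCellFamily W B m n) {i j : ι} (hij : i ≠ j) {p : ℝ × ℝ}
    (hp : p ∈ closure (W j)) : side B m n i j p ≤ 0 :=
  closure_minimal (fun q hq => (h.neg i j hij q hq).le)
    (isClosed_le (continuous_side B m n i j) continuous_const) hp

theorem nonneg (h : IsCellFamily W B m n) {i j : ι} (hij : i ≠ j) {p : ℝ × ℝ}
    (hp : p ∈ closure (W i)) : 0 ≤ side B m n i j p :=
  closure_minimal (fun q hq => (h.pos i j hij q hq).le)
    (isClosed_le continuous_const (continuous_side B m n i j)) hp

theorem mem_iff [Finite ι] (h : IsCellFamily W B m n) {i : ι} {p : ℝ × ℝ} :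
    p ∈ W i ↔ ∀ j, i ≠ j → 0 < side B m n i j p := by
  refine ⟨fun hp j hij => h.pos i j hij p hp, fun hp => ?_⟩
  have hP : IsOpen {q | ∀ j, i ≠ j → 0 < side B m n i j q} := by
    simp only [Set.ofPred_forall]
    exact isOpen_iInter_of_finite fun j => isOpen_iInter_of_finite fun _ =>
      isOpen_lt continuous_const (continuous_side B m n i j)
  refine (h.isOpen i).interior_closure_subset_of_convex (h.convex i)
    (interior_maximal (fun q hq => ?_) hP hp)
  rw [mem_closure_iff]
  intro o ho hqo
  obtain ⟨r, ⟨hro, hrP⟩, hr⟩ := h.dense.inter_open_nonempty _ (ho.inter hP) ⟨q, hqo, hq⟩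
  obtain ⟨j, hj⟩ := Set.mem_iUnion.1 hr
  rcases eq_or_ne i j with rfl | hij
  · exact ⟨r, hro, hj⟩
  · exact absurd (hrP j hij) (h.neg i j hij r hj).not_gt

theorem mem_closure_iff [Finite ι] (h : IsCellFamily W B m n) {i : ι} {p : ℝ × ℝ} :
    p ∈ closure (W i) ↔ ∀ j, i ≠ j → 0 ≤ side B m n i j p := by
  refine ⟨fun hp j hij => h.nonneg hij hp, fun hp => ?_⟩
  obtain ⟨q, hq⟩ := h.nonempty i
  have hcont : Continuous fun ε : ℝ => (1 - ε) • p + ε • q := by fun_prop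
  refine mem_closure_of_tendsto (b := nhdsWithin (0 : ℝ) (Set.Ioi 0))
    ((hcont.tendsto' 0 p (by simp)).mono_left nhdsWithin_le_nhds) ?_
  filter_upwards [self_mem_nhdsWithin, nhdsWithin_le_nhds (Iio_mem_nhds one_pos)] with ε h0 h1
  refine h.mem_iff.2 fun j hij => ?_
  rw [side_combo B m n i j p q (by ring)]
  have h2 : 0 < 1 - ε := sub_pos.2 h1
  have h3 : 0 < ε := h0
  have h4 := hp j hij
  have h5 := h.pos i j hij q hq
  positivity

theorem exists_mem_closure [Finite ι] (h : IsCellFamily W B m n) (p : ℝ × ℝ) :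
    ∃ i, p ∈ closure (W i) := by
  have := h.dense.closure_eq
  rw [closure_iUnion_of_finite] at this
  exact Set.mem_iUnion.1 (this ▸ Set.mem_univ p)

theorem notMem_closure (h : IsCellFamily W B m n) {i j : ι} (hij : i ≠ j) {p : ℝ × ℝ}
    (hp : p ∈ W i) : p ∉ closure (W j) :=
  fun hj => (h.nonpos hij hj).not_gt (h.pos i j hij p hp)

theorem B_ne_zero (h : IsCellFamily W B m n) {i j : ι} (hij : i ≠ j) : B i j ≠ 0 := by
  intro h0
  obtain ⟨p, hp⟩ := h.nonempty i
  simpa [side, h0] using h.pos i j hij p hp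

/-- Two points of a closed cell on a vertical line that supports it coincide. -/
theorem eq_of_fst_eq [Finite ι] (h : IsCellFamily W B m n) {i : ι} {v w : ℝ × ℝ}
    (hv : v ∈ closure (W i)) (hw : w ∈ closure (W i)) (hvw : v.1 = w.1)
    (hno : ∀ p ∈ W i, p.1 ≠ v.1) : v = w := by
  have hmid : (1 / 2 : ℝ) • v + (1 / 2 : ℝ) • w ∉ W i := fun hmem => hno _ hmem <| by
    simp only [Prod.fst_add, Prod.smul_fst, smul_eq_mul, hvw]
    ring
  rw [h.mem_iff] at hmid
  push Not at hmid
  obtain ⟨j, hij, hle⟩ := hmid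
  rw [side_combo B m n i j v w (by norm_num)] at hle
  have h1 := h.nonneg hij hv
  have h2 := h.nonneg hij hw
  have h3 : side B m n i j v = side B m n i j w := by linarith
  rw [side, side, hvw] at h3
  have h4 := mul_left_cancel₀ (h.B_ne_zero hij) h3
  exact Prod.ext hvw (by linarith)

theorem fst_lt_of_leftmost (h : IsCellFamily W B m n) {i : ι} {v p : ℝ × ℝ}
    (hv : ∀ p ∈ closure (W i), v.1 ≤ p.1) (hp : p ∈ W i) : v.1 < p.1 := by
  refine (hv p (subset_closure hp)).lt_of_ne fun heq => ?_
  have hcont : Continuous fun ε : ℝ => (p.1 - ε, p.2) := by fun_prop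
  have := ((hcont.tendsto' 0 p (by simp)).mono_left
    (nhdsWithin_le_nhds (s := Set.Ioi 0))).eventually ((h.isOpen i).mem_nhds hp)
  obtain ⟨ε, hε, hε0⟩ := (this.and self_mem_nhdsWithin).exists
  have h1 := hv _ (subset_closure hε)
  have h2 : 0 < ε := hε0
  simp only at h1
  linarith

theorem fst_lt_of_rightmost (h : IsCellFamily W B m n) {i : ι} {v p : ℝ × ℝ}
    (hv : ∀ p ∈ closure (W i), p.1 ≤ v.1) (hp : p ∈ W i) : p.1 < v.1 := by
  refine (hv p (subset_closure hp)).lt_of_ne fun heq => ?_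
  have hcont : Continuous fun ε : ℝ => (p.1 + ε, p.2) := by fun_prop
  have := ((hcont.tendsto' 0 p (by simp)).mono_left
    (nhdsWithin_le_nhds (s := Set.Ioi 0))).eventually ((h.isOpen i).mem_nhds hp)
  obtain ⟨ε, hε, hε0⟩ := (this.and self_mem_nhdsWithin).exists
  have h1 := hv _ (subset_closure hε)
  have h2 : 0 < ε := hε0
  simp only at h1
  linarith

/-- A closed cell has at most two lateral points. -/
theorem exists_lateral_finset [Finite ι] (h : IsCellFamily W B m n) (i : ι) :
    ∃ E : Finset (ℝ × ℝ), E.card ≤ 2 ∧ ∀ v, v ∈ E ↔ IsLateral (closure (W i)) v := by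
  have hl : {v | v ∈ closure (W i) ∧ ∀ p ∈ closure (W i), v.1 ≤ p.1}.Subsingleton := by
    rintro v ⟨hv, hv'⟩ w ⟨hw, hw'⟩
    exact h.eq_of_fst_eq hv hw (le_antisymm (hv' w hw) (hw' v hv))
      fun p hp => (h.fst_lt_of_leftmost hv' hp).ne'
  have hr : {v | v ∈ closure (W i) ∧ ∀ p ∈ closure (W i), p.1 ≤ v.1}.Subsingleton := by
    rintro v ⟨hv, hv'⟩ w ⟨hw, hw'⟩
    exact h.eq_of_fst_eq hv hw (le_antisymm (hw' v hv) (hv' w hw))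
      fun p hp => (h.fst_lt_of_rightmost hv' hp).ne
  refine ⟨hl.finite.toFinset ∪ hr.finite.toFinset,
    (Finset.card_union_le _ _).trans (add_le_add (?_ : _ ≤ 1) (?_ : _ ≤ 1)), fun v => ?_⟩
  · rw [Finset.card_le_one]
    intro a ha b hb
    rw [Set.Finite.mem_toFinset] at ha hb
    exact hl ha hb
  · rw [Finset.card_le_one]
    intro a ha b hb
    rw [Set.Finite.mem_toFinset] at ha hb
    exact hr ha hb
  · simp only [Finset.mem_union, Set.Finite.mem_toFinset, Set.mem_ofPred_eq, IsLateral]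
    tauto

/-- The vertical line through a nonlateral point of a closed cell meets the cell. -/
theorem exists_mem_vertical (h : IsCellFamily W B m n) {i : ι} {v : ℝ × ℝ}
    (hv : v ∈ closure (W i)) (hl : ¬ IsLateral (closure (W i)) v) : ∃ y, (v.1, y) ∈ W i := by
  unfold IsLateral at hl
  push Not at hl
  obtain ⟨⟨p, hp, hpv⟩, ⟨q, hq, hqv⟩⟩ := hl hv
  obtain ⟨p', hp'v, hp'⟩ := _root_.mem_closure_iff.1 hp {x | x.1 < v.1}
    (isOpen_lt continuous_fst continuous_const) hpv
  obtain ⟨q', hq'v, hq'⟩ := _root_.mem_closure_iff.1 hq {x | v.1 < x.1}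
    (isOpen_lt continuous_const continuous_fst) hqv
  simp only [Set.mem_ofPred_eq] at hp'v hq'v
  have hd : 0 < q'.1 - p'.1 := by linarith
  have hmem := h.convex i hp' hq' (a := (q'.1 - v.1) / (q'.1 - p'.1))
    (b := (v.1 - p'.1) / (q'.1 - p'.1)) (div_nonneg (by linarith) hd.le)
    (div_nonneg (by linarith) hd.le) (by field_simp; ring)
  obtain ⟨z, hz, hzv⟩ : ∃ z ∈ W i, z.1 = v.1 := by
    refine ⟨_, hmem, ?_⟩
    simp only [Prod.fst_add, Prod.smul_fst, smul_eq_mul]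
    field_simp
    ring
  exact ⟨z.2, hzv ▸ hz⟩

/-- Two cells with `v` in their closures that contain points of the vertical line through `v` on
the same side of `v` coincide. -/
theorem eq_of_vertical (h : IsCellFamily W B m n) {i j : ι} {v : ℝ × ℝ}
    (hi : v ∈ closure (W i)) (hj : v ∈ closure (W j)) {y z : ℝ} (hy : (v.1, y) ∈ W i)
    (hz : (v.1, z) ∈ W j) (hyz : 0 ≤ (y - v.2) * (z - v.2)) : i = j := by
  by_contra hij
  have hiv : v ∉ W i := fun hv => h.notMem_closure hij hv hj
  have hjv : v ∉ W j := fun hv => h.notMem_closure (Ne.symm hij) hv hi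
  have h1 := h.nonpos hij hj
  have h2 := h.nonneg hij hi
  have h3 := h.pos i j hij _ hy
  have h4 := h.neg i j hij _ hz
  have h0 : v.2 - (m i j * v.1 + n i j) = 0 := by
    have : side B m n i j v = 0 := le_antisymm h1 h2
    exact (mul_eq_zero.1 this).resolve_left (h.B_ne_zero hij)
  have h5 : 0 < B i j * (y - v.2) := by
    convert h3 using 1
    simp only [side]
    linear_combination -B i j * h0
  have h6 : B i j * (z - v.2) < 0 := by
    convert h4 using 1
    simp only [side]
    linear_combination -B i j * h0
  have h7 : B i j ^ 2 * ((y - v.2) * (z - v.2)) < 0 := by nlinarith [mul_neg_of_pos_of_neg h5 h6]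
  nlinarith [sq_nonneg (B i j), mul_nonneg (sq_nonneg (B i j)) hyz]

/-- Apart from the cells of which it is a lateral point, a point lies on at most two closed
cells. -/
theorem card_nonlateral_le [Fintype ι] (h : IsCellFamily W B m n) (v : ℝ × ℝ) :
    (Finset.univ.filter fun i =>
      v ∈ closure (W i) ∧ ¬ IsLateral (closure (W i)) v).card ≤ 2 := by
  have hsub : (Finset.univ.filter fun i =>
      v ∈ closure (W i) ∧ ¬ IsLateral (closure (W i)) v) ⊆
      (Finset.univ.filter fun i => v ∈ closure (W i) ∧ ∃ y, v.2 ≤ y ∧ (v.1, y) ∈ W i) ∪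
      (Finset.univ.filter fun i => v ∈ closure (W i) ∧ ∃ y, y ≤ v.2 ∧ (v.1, y) ∈ W i) := by
    intro i hi
    simp only [Finset.mem_filter, Finset.mem_union, Finset.mem_univ, true_and] at hi ⊢
    obtain ⟨y, hy⟩ := h.exists_mem_vertical hi.1 hi.2
    rcases le_total v.2 y with hle | hle
    · exact Or.inl ⟨hi.1, y, hle, hy⟩
    · exact Or.inr ⟨hi.1, y, hle, hy⟩
  refine (Finset.card_le_card hsub).trans ((Finset.card_union_le _ _).trans
    (add_le_add (?_ : _ ≤ 1) (?_ : _ ≤ 1)))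
  · rw [Finset.card_le_one]
    intro i hi j hj
    simp only [Finset.mem_filter, Finset.mem_univ, true_and] at hi hj
    obtain ⟨hi, y, hy, hyi⟩ := hi
    obtain ⟨hj, z, hz, hzj⟩ := hj
    exact h.eq_of_vertical hi hj hyi hzj (mul_nonneg (by linarith) (by linarith))
  · rw [Finset.card_le_one]
    intro i hi j hj
    simp only [Finset.mem_filter, Finset.mem_univ, true_and] at hi hj
    obtain ⟨hi, y, hy, hyi⟩ := hi
    obtain ⟨hj, z, hz, hzj⟩ := hj
    exact h.eq_of_vertical hi hj hyi hzj
      (mul_nonneg_of_nonpos_of_nonpos (by linarith) (by linarith))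

theorem eventually_vertical {o : Set (ℝ × ℝ)} (ho : IsOpen o) {p : ℝ × ℝ} (hp : p ∈ o) (t : ℝ) :
    ∀ᶠ ε in nhdsWithin (0 : ℝ) (Set.Ioi 0), (p.1, p.2 + ε * t) ∈ o := by
  have hcont : Continuous fun ε : ℝ => (p.1, p.2 + ε * t) := by fun_prop
  exact ((hcont.tendsto' 0 p (by simp)).mono_left nhdsWithin_le_nhds).eventually (ho.mem_nhds hp)

theorem side_vertical (B m n : ι → ι → ℝ) (i j : ι) (p : ℝ × ℝ) (t : ℝ) :
    side B m n i j (p.1, p.2 + t) = side B m n i j p + B i j * t := by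
  simp only [side]
  ring

/-- Near a point that is not lateral for any cell, a line supporting a closed cell at the point
stays in that closed cell. -/
theorem eventually_mem_line [Finite ι] (h : IsCellFamily W B m n) {i j : ι} (hij : i ≠ j)
    {v : ℝ × ℝ} (hvi : v ∈ closure (W i)) (hv : ∀ l, ¬ IsLateral (closure (W l)) v)
    (hv0 : v.2 = m i j * v.1 + n i j) :
    ∀ᶠ s in nhds v.1, (s, m i j * s + n i j) ∈ closure (W i) := by
  set N : Set (ℝ × ℝ) := {p | ∀ l, v ∉ closure (W l) → p ∉ closure (W l)} with hN
  have hNo : IsOpen N := by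
    simp only [hN, Set.ofPred_forall]
    exact isOpen_iInter_of_finite fun l => isOpen_iInter_of_finite fun _ =>
      isClosed_closure.isOpen_compl
  have hvN : v ∈ N := fun l hl => hl
  have hNex : ∀ p ∈ N, ∃ l, v ∈ closure (W l) ∧ p ∈ closure (W l) := by
    intro p hp
    obtain ⟨l, hl⟩ := h.exists_mem_closure p
    exact ⟨l, by_contra fun hvl => hp l hvl hl, hl⟩
  have hvij : side B m n i j v = 0 := by
    simp only [side]
    rw [hv0]
    ring
  obtain ⟨y, hy⟩ := h.exists_mem_vertical hvi (hv i)
  set t := y - v.2 with ht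
  have hyt : (v.1, y) = (v.1, v.2 + t) := by rw [ht]; congr 1; ring
  have hBij : 0 < B i j * t := by
    have := h.pos i j hij _ hy
    rwa [hyt, side_vertical, hvij, zero_add] at this
  obtain ⟨k, hvk, hik⟩ : ∃ k, v ∈ closure (W k) ∧ i ≠ k := by
    obtain ⟨ε, hεN, hε⟩ := ((eventually_vertical hNo hvN (-t)).and self_mem_nhdsWithin).exists
    obtain ⟨k, hvk, hk⟩ := hNex _ hεN
    refine ⟨k, hvk, ?_⟩
    rintro rfl
    have h1 := h.nonneg hij hk
    rw [side_vertical, hvij] at h1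
    have h2 : 0 < ε := hε
    nlinarith [mul_pos h2 hBij]
  obtain ⟨z, hz⟩ := h.exists_mem_vertical hvk (hv k)
  have huniq : ∀ l, v ∈ closure (W l) → l = i ∨ l = k := by
    intro l hl
    by_contra! hne
    obtain ⟨x, hx⟩ := h.exists_mem_vertical hl (hv l)
    have h1 : (y - v.2) * (z - v.2) < 0 := not_le.1 fun hle =>
      hik (h.eq_of_vertical hvi hvk hy hz hle)
    have h2 : (x - v.2) * (y - v.2) < 0 := not_le.1 fun hle =>
      hne.1 (h.eq_of_vertical hl hvi hx hy hle)
    have h3 : (x - v.2) * (z - v.2) < 0 := not_le.1 fun hle =>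
      hne.2 (h.eq_of_vertical hl hvk hx hz hle)
    have h4 : 0 < ((x - v.2) * (y - v.2)) * ((x - v.2) * (z - v.2)) := mul_pos_of_neg_of_neg h2 h3
    nlinarith [mul_nonpos_of_nonneg_of_nonpos (sq_nonneg (x - v.2)) h1.le]
  have hvik : side B m n i k v = 0 := le_antisymm (h.nonpos hik hvk) (h.nonneg hik hvi)
  have hBik : 0 < B i k * t := by
    have := h.pos i k hik _ hy
    rwa [hyt, side_vertical, hvik, zero_add] at this
  have hmem : ∀ p ∈ N, 0 < side B m n i k p → p ∈ closure (W i) := by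
    intro p hp hpos
    obtain ⟨l, hvl, hl⟩ := hNex p hp
    rcases huniq l hvl with rfl | rfl
    · exact hl
    · exact absurd hpos (h.nonpos hik hl).not_gt
  have hcont : Continuous fun s : ℝ => (s, m i j * s + n i j) := by fun_prop
  have hcont' : Continuous fun s : ℝ => (2 * v.1 - s, m i j * (2 * v.1 - s) + n i j) := by fun_prop
  filter_upwards [(hcont.tendsto' v.1 v (Prod.ext rfl hv0.symm)).eventually (hNo.mem_nhds hvN),
    (hcont'.tendsto' v.1 v (Prod.ext (by ring) (by rw [hv0]; ring))).eventually
      (hNo.mem_nhds hvN)] with s hs hs'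
  rcases le_or_gt 0 (side B m n i k (s, m i j * s + n i j)) with hle | hlt
  · refine isClosed_closure.mem_of_tendsto (b := nhdsWithin (0 : ℝ) (Set.Ioi 0))
      (f := fun ε : ℝ => (s, m i j * s + n i j + ε * t))
      (((by fun_prop : Continuous fun ε : ℝ => (s, m i j * s + n i j + ε * t)).tendsto' 0 _
        (by simp)).mono_left nhdsWithin_le_nhds) ?_
    filter_upwards [eventually_vertical hNo hs t, self_mem_nhdsWithin] with ε hε hε0
    refine hmem _ hε ?_
    have h1 := side_vertical B m n i k (s, m i j * s + n i j) (ε * t)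
    simp only at h1
    rw [h1]
    have h2 : 0 < ε := hε0
    nlinarith [mul_pos h2 hBik]
  · exfalso
    set p' : ℝ × ℝ := (2 * v.1 - s, m i j * (2 * v.1 - s) + n i j) with hp'
    have hp'pos : 0 < side B m n i k p' := by
      have : side B m n i k p' = -side B m n i k (s, m i j * s + n i j) := by
        rw [← sub_eq_zero] at hvik ⊢
        simp only [side, hp'] at hvik ⊢
        rw [hv0] at hvik
        linear_combination 2 * hvik
      rw [this]
      linarith
    have ho : IsOpen (N ∩ {p | 0 < side B m n i k p}) :=
      hNo.inter (isOpen_lt continuous_const (continuous_side B m n i k))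
    obtain ⟨ε, ⟨hεN, hεp⟩, hε0⟩ :=
      ((eventually_vertical ho ⟨hs', hp'pos⟩ (-t)).and self_mem_nhdsWithin).exists
    have h1 := h.nonneg hij (hmem _ hεN hεp)
    rw [side_vertical] at h1
    have h2 : 0 < ε := hε0
    have h3 : side B m n i j p' = 0 := by
      simp only [side, hp']
      ring
    nlinarith [mul_pos h2 hBij]

/-- A line supporting a closed cell supports it over every interval free of lateral points. -/
theorem mem_line_of_isPreconnected [Finite ι] (h : IsCellFamily W B m n) {i j : ι} (hij : i ≠ j)
    {I : Set ℝ} (hI : IsPreconnected I)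
    (hv : ∀ v ∈ closure (W i), v.1 ∈ I → ∀ l, ¬ IsLateral (closure (W l)) v) {s₀ : ℝ}
    (hs₀ : s₀ ∈ I) (hmem : (s₀, m i j * s₀ + n i j) ∈ closure (W i)) {s : ℝ} (hs : s ∈ I) :
    (s, m i j * s + n i j) ∈ closure (W i) := by
  set Z : Set ℝ := {s | (s, m i j * s + n i j) ∈ closure (W i)} with hZ
  have hZc : IsClosed Z := isClosed_closure.preimage (by fun_prop)
  have hZint : ∀ s ∈ Z, s ∈ I → s ∈ interior Z := fun s hsZ hsI =>
    mem_interior_iff_mem_nhds.2 (h.eventually_mem_line hij hsZ (hv _ hsZ hsI) rfl)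
  have hsub : I ⊆ interior Z := hI.subset_of_closure_inter_subset isOpen_interior
    ⟨s₀, hs₀, hZint s₀ hmem hs₀⟩
    fun x hx => hZint x (closure_minimal interior_subset hZc hx.1) hx.2
  exact interior_subset (s := Z) (hsub hs)

end IsCellFamily

theorem hasTiling_three_of_trivial_or_nonconst {c₁ c₂ c₃ : ℝ × ℝ × ℝ}
    (h₁ : c₁ = (0, 0, 1) ∨ NonconstAff c₁) (h₂ : c₂ = (0, 0, 1) ∨ NonconstAff c₂)
    (h₃ : c₃ = (0, 0, 1) ∨ NonconstAff c₃) :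
    HasTiling {p | 0 < aff c₁ p ∧ 0 < aff c₂ p ∧ 0 < aff c₃ p} 2 := by
  by_cases hall : NonconstAff c₁ ∨ NonconstAff c₂ ∨ NonconstAff c₃
  · exact (hasTiling_three c₁ c₂ c₃ hall).mono one_le_two
  · push Not at hall
    rw [h₁.resolve_right hall.1, h₂.resolve_right hall.2.1, h₃.resolve_right hall.2.2]
    convert hasTiling_univ
    simp [aff]

/-- The region between two nonvertical and two vertical lines, any of which may be absent. -/
theorem hasTiling_four {c₁ c₂ c₃ c₄ : ℝ × ℝ × ℝ}
    (h₁ : c₁ = (0, 0, 1) ∨ ∃ a, c₁ = (1, 0, -a)) (h₂ : c₂ = (0, 0, 1) ∨ ∃ b, c₂ = (-1, 0, b))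
    (h₃ : c₃ = (0, 0, 1) ∨ ∃ m n, c₃ = (-m, 1, -n))
    (h₄ : c₄ = (0, 0, 1) ∨ ∃ m n, c₄ = (m, -1, n)) :
    HasTiling {p | 0 < aff c₁ p ∧ 0 < aff c₂ p ∧ 0 < aff c₃ p ∧ 0 < aff c₄ p} 2 := by
  have hn₁ : c₁ = (0, 0, 1) ∨ NonconstAff c₁ :=
    h₁.imp_right fun ⟨a, ha⟩ => by simp [ha, NonconstAff]
  have hn₂ : c₂ = (0, 0, 1) ∨ NonconstAff c₂ :=
    h₂.imp_right fun ⟨a, ha⟩ => by simp [ha, NonconstAff]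
  have hn₃ : c₃ = (0, 0, 1) ∨ NonconstAff c₃ :=
    h₃.imp_right fun ⟨a, b, ha⟩ => by simp [ha, NonconstAff]
  have hn₄ : c₄ = (0, 0, 1) ∨ NonconstAff c₄ :=
    h₄.imp_right fun ⟨a, b, ha⟩ => by simp [ha, NonconstAff]
  have htriv : ∀ p, 0 < aff (0, 0, 1) p := by simp [aff]
  rcases h₁ with rfl | ⟨a, rfl⟩
  · simpa only [htriv, true_and] using hasTiling_three_of_trivial_or_nonconst hn₂ hn₃ hn₄
  rcases h₂ with rfl | ⟨b, rfl⟩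
  · simpa only [htriv, true_and] using hasTiling_three_of_trivial_or_nonconst hn₁ hn₃ hn₄
  rcases h₃ with rfl | ⟨m, n, rfl⟩
  · simpa only [htriv, true_and] using hasTiling_three_of_trivial_or_nonconst hn₁ hn₂ hn₄
  rcases h₄ with rfl | ⟨m', n', rfl⟩
  · simpa only [htriv, and_true] using hasTiling_three_of_trivial_or_nonconst hn₁ hn₂ hn₃
  convert hasTiling_trapezoid a b m n m' n' using 1
  ext p
  simp only [aff, Set.mem_ofPred_eq]
  constructor <;> rintro ⟨h1, h2, h3, h4⟩ <;>
    exact ⟨by linarith, by linarith, by linarith, by linarith⟩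

/-- The abscissas on which two affine functions are positive. -/
def slab (c₁ c₂ : ℝ × ℝ × ℝ) : Set ℝ := {s | 0 < aff c₁ (s, 0) ∧ 0 < aff c₂ (s, 0)}

theorem convex_slab (c₁ c₂ : ℝ × ℝ × ℝ) : Convex ℝ (slab c₁ c₂) := by
  intro x hx y hy a b ha hb hab
  have key : ∀ c, 0 < aff c (x, 0) → 0 < aff c (y, 0) → 0 < aff c (a • x + b • y, 0) := by
    intro c hx hy
    simpa using convex_aff_pos c hx hy ha hb hab
  exact ⟨key c₁ hx.1 hy.1, key c₂ hx.2 hy.2⟩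

theorem isOpen_slab (c₁ c₂ : ℝ × ℝ × ℝ) : IsOpen (slab c₁ c₂) :=
  ((isOpen_aff_pos c₁).preimage (by fun_prop : Continuous fun s : ℝ => (s, (0 : ℝ)))).inter
    ((isOpen_aff_pos c₂).preimage (by fun_prop : Continuous fun s : ℝ => (s, (0 : ℝ))))

namespace IsCellFamily

variable {ι : Type*} {W : ι → Set (ℝ × ℝ)} {B m n : ι → ι → ℝ}

/-- Over an interval free of lateral points, the constraints bounding a cell from below (`σ = 1`)
or from above (`σ = -1`) follow from a single one. -/
theorem exists_bound [Fintype ι] (h : IsCellFamily W B m n) (i : ι) {σ : ℝ}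
    (hσ : σ = 1 ∨ σ = -1) {I : Set ℝ} (hI : IsPreconnected I)
    (hv : ∀ v ∈ closure (W i), v.1 ∈ I → ∀ l, ¬ IsLateral (closure (W l)) v) {p : ℝ × ℝ}
    (hp : p ∈ W i) (hpI : p.1 ∈ I) :
    ∃ c : ℝ × ℝ × ℝ, (c = (0, 0, 1) ∨ ∃ m n, c = (-σ * m, σ, -σ * n)) ∧
      (∀ q ∈ W i, 0 < aff c q) ∧
      (∀ q : ℝ × ℝ, q.1 ∈ I → 0 < aff c q → ∀ j, i ≠ j → 0 < σ * B i j →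
        0 < side B m n i j q) := by
  have hσ2 : σ * σ = 1 := by rcases hσ with rfl | rfl <;> norm_num
  have hfac : ∀ b x : ℝ, b * x = σ * b * (σ * x) := fun b x => by
    linear_combination (-b * x) * hσ2
  set J : Finset ι := Finset.univ.filter fun j => i ≠ j ∧ 0 < σ * B i j with hJ
  have hJm : ∀ j, j ∈ J ↔ i ≠ j ∧ 0 < σ * B i j := by simp [hJ]
  rcases J.eq_empty_or_nonempty with he | hne
  · refine ⟨(0, 0, 1), Or.inl rfl, by simp [aff], fun q _ _ j hij hj => ?_⟩
    exact absurd ((hJm j).2 ⟨hij, hj⟩) (by simp [he])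
  obtain ⟨j, hjJ, hjmax⟩ := J.exists_max_image (fun j => σ * (m i j * p.1 + n i j)) hne
  obtain ⟨hij, hj⟩ := (hJm j).1 hjJ
  have haff : ∀ q : ℝ × ℝ, aff (-σ * m i j, σ, -σ * n i j) q =
      σ * (q.2 - (m i j * q.1 + n i j)) := by
    intro q
    simp only [aff]
    ring
  have hpos : ∀ q ∈ W i, 0 < σ * (q.2 - (m i j * q.1 + n i j)) := by
    intro q hq
    have h1 := h.pos i j hij q hq
    rw [side, hfac] at h1
    exact pos_of_mul_pos_right h1 hj.le
  have hline : (p.1, m i j * p.1 + n i j) ∈ closure (W i) := by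
    refine h.mem_closure_iff.2 fun k hik => ?_
    have h1 := h.pos i k hik p hp
    simp only [side] at h1 ⊢
    by_cases hk : 0 < σ * B i k
    · have h2 := hjmax k ((hJm k).2 ⟨hik, hk⟩)
      rw [hfac]
      exact mul_nonneg hk.le (by linarith)
    · have h2 := mul_nonneg (neg_nonneg.2 (not_lt.1 hk)) (hpos p hp).le
      rw [hfac] at h1 ⊢
      linarith
  refine ⟨_, Or.inr ⟨m i j, n i j, rfl⟩, fun q hq => (haff q).symm ▸ hpos q hq,
    fun q hqI hq k hik hk => ?_⟩
  have h1 := h.nonneg hik (h.mem_line_of_isPreconnected hij hI hv hpI hline hqI)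
  rw [haff] at hq
  simp only [side] at h1 ⊢
  have h2 := mul_pos hk hq
  rw [hfac] at h1 ⊢
  linarith

theorem hasTiling_of_forall_not_isLateral [Fintype ι] (h : IsCellFamily W B m n) (i : ι)
    {c₁ c₂ : ℝ × ℝ × ℝ} (h₁ : c₁ = (0, 0, 1) ∨ ∃ a, c₁ = (1, 0, -a))
    (h₂ : c₂ = (0, 0, 1) ∨ ∃ b, c₂ = (-1, 0, b))
    (hv : ∀ v ∈ closure (W i), v.1 ∈ slab c₁ c₂ → ∀ l, ¬ IsLateral (closure (W l)) v) :
    HasTiling (W i ∩ Prod.fst ⁻¹' slab c₁ c₂) 2 := by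
  rcases (W i ∩ Prod.fst ⁻¹' slab c₁ c₂).eq_empty_or_nonempty with he | ⟨p, hp, hpI⟩
  · rw [he]
    exact hasTiling_empty 2
  have hI := (convex_slab c₁ c₂).isPreconnected
  obtain ⟨c₃, h₃, h₃W, h₃s⟩ := h.exists_bound i (Or.inl rfl) hI hv hp hpI
  obtain ⟨c₄, h₄, h₄W, h₄s⟩ := h.exists_bound i (Or.inr rfl) hI hv hp hpI
  have h₃' : c₃ = (0, 0, 1) ∨ ∃ m n, c₃ = (-m, 1, -n) := by simpa using h₃
  have h₄' : c₄ = (0, 0, 1) ∨ ∃ m n, c₄ = (m, -1, n) := by simpa using h₄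
  convert hasTiling_four h₁ h₂ h₃' h₄' using 1
  have hc₁ : ∀ q : ℝ × ℝ, aff c₁ (q.1, 0) = aff c₁ q := by
    rcases h₁ with rfl | ⟨a, rfl⟩ <;> simp [aff]
  have hc₂ : ∀ q : ℝ × ℝ, aff c₂ (q.1, 0) = aff c₂ q := by
    rcases h₂ with rfl | ⟨a, rfl⟩ <;> simp [aff]
  ext q
  have hq : q.1 ∈ slab c₁ c₂ ↔ 0 < aff c₁ q ∧ 0 < aff c₂ q := by
    rw [← hc₁, ← hc₂]
    rfl
  simp only [Set.mem_inter_iff, Set.mem_preimage, Set.mem_ofPred_eq]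
  constructor
  · rintro ⟨hqW, hqI⟩
    exact ⟨(hq.1 hqI).1, (hq.1 hqI).2, h₃W q hqW, h₄W q hqW⟩
  · rintro ⟨hq₁, hq₂, hq₃, hq₄⟩
    have hqI := hq.2 ⟨hq₁, hq₂⟩
    refine ⟨h.mem_iff.2 fun j hij => ?_, hqI⟩
    rcases lt_or_gt_of_ne (h.B_ne_zero hij) with hB | hB
    · exact h₄s q hqI hq₄ j hij (by linarith)
    · exact h₃s q hqI hq₃ j hij (by linarith)

theorem hasTiling_slab [Fintype ι] (h : IsCellFamily W B m n) (i : ι) {S : Finset ℝ}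
    (hS : ∀ v ∈ closure (W i), ∀ l, IsLateral (closure (W l)) v → v.1 ∈ S)
    {c₁ c₂ : ℝ × ℝ × ℝ} (h₁ : c₁ = (0, 0, 1) ∨ ∃ a, c₁ = (1, 0, -a))
    (h₂ : c₂ = (0, 0, 1) ∨ ∃ b, c₂ = (-1, 0, b)) :
    HasTiling (W i ∩ Prod.fst ⁻¹' slab c₁ c₂)
      (2 * ((S.filter fun s => s ∈ slab c₁ c₂).card + 1)) := by
  induction hN : (S.filter fun s => s ∈ slab c₁ c₂).card using Nat.strong_induction_on
    generalizing c₁ c₂ with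
  | _ N ih =>
  rcases (S.filter fun s => s ∈ slab c₁ c₂).eq_empty_or_nonempty with he | ⟨x, hx⟩
  · refine (h.hasTiling_of_forall_not_isLateral i h₁ h₂ fun v hv hvI l hl => ?_).mono (by omega)
    have : v.1 ∈ S.filter fun s => s ∈ slab c₁ c₂ := Finset.mem_filter.2 ⟨hS v hv l hl, hvI⟩
    simp [he] at this
  obtain ⟨hxS, hx₁, hx₂⟩ := Finset.mem_filter.1 hx
  have hl : slab c₁ (-1, 0, x) = slab c₁ c₂ ∩ Set.Iio x := by
    ext s
    refine ⟨fun hs => ?_, fun hs => ⟨hs.1.1, ?_⟩⟩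
    · have hsx : s < x := by simpa [aff] using hs.2
      refine ⟨⟨hs.1, ?_⟩, hsx⟩
      rcases h₂ with rfl | ⟨b, rfl⟩
      · simp [aff]
      · simp only [aff] at hx₂ ⊢
        linarith
    · simpa [aff] using hs.2
  have hr : slab (1, 0, -x) c₂ = slab c₁ c₂ ∩ Set.Ioi x := by
    ext s
    refine ⟨fun hs => ?_, fun hs => ⟨?_, hs.1.2⟩⟩
    · have hsx : x < s := by simpa [aff] using hs.1
      refine ⟨⟨?_, hs.2⟩, hsx⟩
      rcases h₁ with rfl | ⟨b, rfl⟩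
      · simp [aff]
      · simp only [aff] at hx₁ ⊢
        linarith
    · simpa [aff] using hs.2
  have hsum : (S.filter fun s => s ∈ slab c₁ (-1, 0, x)).card +
      (S.filter fun s => s ∈ slab (1, 0, -x) c₂).card + 1 ≤ N := by
    rw [← hN, ← Finset.card_union_of_disjoint, Nat.succ_le_iff]
    · refine Finset.card_lt_card ⟨fun s hs => ?_, fun hsub => ?_⟩
      · simp only [Finset.mem_union, Finset.mem_filter, hl, hr] at hs ⊢
        rcases hs with hs | hs
        · exact ⟨hs.1, hs.2.1⟩
        · exact ⟨hs.1, hs.2.1⟩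
      · have := hsub hx
        simp [hl, hr] at this
    · rw [Finset.disjoint_left]
      intro s hs hs'
      simp only [Finset.mem_filter, hl, hr] at hs hs'
      exact lt_asymm (a := s) (b := x) hs.2.2 hs'.2.2
  have ho : ∀ c₁ c₂, IsOpen (W i ∩ Prod.fst ⁻¹' slab c₁ c₂) := fun c₁ c₂ =>
    (h.isOpen i).inter ((isOpen_slab c₁ c₂).preimage continuous_fst)
  have hc : ∀ c₁ c₂, Convex ℝ (W i ∩ Prod.fst ⁻¹' slab c₁ c₂) := fun c₁ c₂ =>
    (h.convex i).inter ((convex_slab c₁ c₂).linear_preimage (LinearMap.fst ℝ ℝ ℝ))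
  refine (HasTiling.of_split
    (ih _ (by omega) (c₁ := c₁) (c₂ := (-1, 0, x)) h₁ (Or.inr ⟨x, rfl⟩) rfl)
    (ih _ (by omega) (c₁ := (1, 0, -x)) (c₂ := c₂) (Or.inr ⟨x, rfl⟩) h₂ rfl)
    (ho _ _) (ho _ _) (hc _ _) (hc _ _) ?_ ?_ ?_ (subset_closure_of_aff_ne (c := (1, 0, -x))
      (ho _ _) (Or.inl one_ne_zero) ?_)).mono (by omega)
  · rw [Set.disjoint_left]
    rintro p ⟨-, hp⟩ ⟨-, hp'⟩
    rw [Set.mem_preimage, hl] at hp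
    rw [Set.mem_preimage, hr] at hp'
    exact lt_asymm (a := p.1) (b := x) hp.2 hp'.2
  · rw [hl]
    exact fun p hp => ⟨hp.1, hp.2.1⟩
  · rw [hr]
    exact fun p hp => ⟨hp.1, hp.2.1⟩
  · rintro p ⟨hpW, hpI⟩ hne
    rw [hl, hr]
    rcases lt_or_gt_of_ne hne with hlt | hlt
    · exact Or.inl ⟨hpW, hpI, by simpa [aff] using hlt⟩
    · exact Or.inr ⟨hpW, hpI, by simpa [aff] using hlt⟩

/-- The closed cells can be tiled by linearly many triangles. -/
theorem exists_tiling [Fintype ι] (h : IsCellFamily W B m n) :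
    ∃ T : Finset (Set (ℝ × ℝ)), T.card ≤ 14 * Fintype.card ι ∧
      (∀ Δ ∈ T, IsTri Δ ∧ ∃ i, Δ ⊆ closure (W i)) ∧
      (∀ Δ₁ ∈ T, ∀ Δ₂ ∈ T, Δ₁ ≠ Δ₂ → interior Δ₁ ∩ interior Δ₂ = ∅) ∧
      ⋃₀ (T : Set (Set (ℝ × ℝ))) = Set.univ := by
  choose E hEcard hE using h.exists_lateral_finset
  set V : Finset (ℝ × ℝ) := Finset.univ.biUnion E with hV
  have hVcard : V.card ≤ Fintype.card ι * 2 := by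
    simpa using Finset.card_biUnion_le_card_mul Finset.univ E 2 fun i _ => hEcard i
  set V' : ι → Finset (ℝ × ℝ) := fun i => V.filter fun v => v ∈ closure (W i) with hV'
  have htile : ∀ i, HasTiling (W i) (2 * ((V' i).card + 1)) := by
    intro i
    have hS := h.hasTiling_slab i (S := (V' i).image Prod.fst) (c₁ := (0, 0, 1))
      (c₂ := (0, 0, 1)) (fun v hv l hl => Finset.mem_image_of_mem _ (Finset.mem_filter.2
        ⟨Finset.mem_biUnion.2 ⟨l, Finset.mem_univ l, (hE l v).2 hl⟩, hv⟩)) (Or.inl rfl) (Or.inl rfl)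
    have huniv : W i ∩ Prod.fst ⁻¹' slab (0, 0, 1) (0, 0, 1) = W i := by simp [slab, aff]
    rw [huniv] at hS
    refine hS.mono ?_
    have := (Finset.card_filter_le ((V' i).image Prod.fst)
      fun s => s ∈ slab (0, 0, 1) (0, 0, 1)).trans Finset.card_image_le
    omega
  have hcount : ∑ i, (V' i).card ≤ 6 * Fintype.card ι := by
    have h1 : ∀ i, (V' i).card ≤
        2 + (V.filter fun v => v ∈ closure (W i) ∧ ¬ IsLateral (closure (W i)) v).card := by
      intro i
      refine (Finset.card_le_card (t := E i ∪ _) fun v hv => ?_).trans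
        ((Finset.card_union_le _ _).trans (Nat.add_le_add_right (hEcard i) _))
      obtain ⟨hvV, hvi⟩ := Finset.mem_filter.1 hv
      rw [Finset.mem_union, Finset.mem_filter, hE]
      tauto
    have h2 : ∑ i, (V.filter fun v =>
        v ∈ closure (W i) ∧ ¬ IsLateral (closure (W i)) v).card ≤ V.card * 2 := by
      have := Finset.sum_card_bipartiteAbove_eq_sum_card_bipartiteBelow
        (s := (Finset.univ : Finset ι)) (t := V)
        (fun i v => v ∈ closure (W i) ∧ ¬ IsLateral (closure (W i)) v)
      simp only [Finset.bipartiteAbove, Finset.bipartiteBelow] at this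
      rw [this]
      exact Finset.sum_le_card_nsmul _ _ _ fun v _ => h.card_nonlateral_le v
    have h3 := Finset.sum_le_sum fun i (_ : i ∈ Finset.univ) => h1 i
    rw [Finset.sum_add_distrib] at h3
    simp only [Finset.sum_const, Finset.card_univ, smul_eq_mul] at h3
    omega
  obtain ⟨T, hT₁, hT₂, hT₃, hT₄⟩ := exists_tiling_iUnion h.isOpen h.convex
    (fun i j hij => h.disjoint hij) htile
  refine ⟨T, hT₁.trans ?_, hT₂, hT₃, Set.eq_univ_of_univ_subset (h.dense.closure_eq ▸ hT₄)⟩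
  rw [← Finset.mul_sum, Finset.sum_add_distrib]
  simp only [Finset.sum_const, Finset.card_univ, smul_eq_mul]
  omega

end IsCellFamily

/-! ### Shearing the plane -/

/-- The shear `x ↦ (x 0 + t * x 1, x 1)`. -/
def shear (t : ℝ) : Plane ≃ₜ ℝ × ℝ where
  toFun x := (x 0 + t * x 1, x 1)
  invFun p := ![p.1 - t * p.2, p.2]
  left_inv x := by
    ext i
    fin_cases i <;> simp
  right_inv p := by
    ext <;> simp
  continuous_toFun := by fun_prop
  continuous_invFun := by
    refine continuous_pi fun i => ?_
    fin_cases i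
    · exact continuous_fst.sub (continuous_const.mul continuous_snd)
    · exact continuous_snd

theorem shear_apply (t : ℝ) (x : Plane) : shear t x = (x 0 + t * x 1, x 1) := rfl

theorem shear_symm_apply (t : ℝ) (p : ℝ × ℝ) : (shear t).symm p = ![p.1 - t * p.2, p.2] := rfl

theorem isLinearMap_shear_symm (t : ℝ) : IsLinearMap ℝ (shear t).symm where
  map_add p q := by
    ext i
    fin_cases i <;> simp [shear_symm_apply]
    ring
  map_smul a p := by
    ext i
    fin_cases i <;> simp [shear_symm_apply]
    ring

theorem exists_separating_line {A B : Set Plane} (hAo : IsOpen A) (hAc : Convex ℝ A)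
    (hBo : IsOpen B) (hBc : Convex ℝ B) (hAB : Disjoint A B) :
    ∃ a b u : ℝ, (∀ x ∈ A, a * x 0 + b * x 1 < u) ∧ ∀ x ∈ B, u < a * x 0 + b * x 1 := by
  obtain ⟨f, u, hA, hB⟩ := geometric_hahn_banach_open_open hAc hAo hBc hBo hAB
  have hf : ∀ x : Plane, f x = f (Pi.single 0 1) * x 0 + f (Pi.single 1 1) * x 1 := by
    intro x
    have hx : x = x 0 • Pi.single 0 1 + x 1 • Pi.single 1 1 := by
      ext i
      fin_cases i <;> simp
    conv_lhs => rw [hx]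
    rw [map_add, map_smul, map_smul, smul_eq_mul, smul_eq_mul, mul_comm, mul_comm (x 1)]
  exact ⟨_, _, u, fun x hx => hf x ▸ hA x hx, fun x hx => hf x ▸ hB x hx⟩

/-- A finite disjoint family of open convex sets becomes a cell family after a shear. -/
theorem exists_isCellFamily_shear {ι : Type*} [Finite ι] {W : ι → Set Plane}
    (ho : ∀ i, IsOpen (W i)) (hc : ∀ i, Convex ℝ (W i)) (hne : ∀ i, (W i).Nonempty)
    (hd : Pairwise fun i j => Disjoint (W i) (W j)) (hdense : Dense (⋃ i, W i)) :
    ∃ (t : ℝ) (B m n : ι → ι → ℝ), IsCellFamily (fun i => (shear t).symm ⁻¹' W i) B m n := by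
  have hsep : ∀ i j, ∃ a b u : ℝ, i ≠ j →
      (∀ x ∈ W i, a * x 0 + b * x 1 < u) ∧ ∀ x ∈ W j, u < a * x 0 + b * x 1 := by
    intro i j
    by_cases hij : i = j
    · exact ⟨0, 0, 0, fun h => absurd hij h⟩
    · obtain ⟨a, b, u, h⟩ := exists_separating_line (ho i) (hc i) (ho j) (hc j) (hd hij)
      exact ⟨a, b, u, fun _ => h⟩
  choose a b u hau using hsep
  obtain ⟨t, ht⟩ := (Set.finite_range fun k : ι × ι => b k.1 k.2 / a k.1 k.2).exists_notMem
  have hb : ∀ i j, i ≠ j → b i j - t * a i j ≠ 0 := by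
    intro i j hij h0
    obtain ⟨x, hx⟩ := hne i
    obtain ⟨y, hy⟩ := hne j
    have ha : a i j ≠ 0 := by
      intro ha
      have hx' := (hau i j hij).1 x hx
      have hy' := (hau i j hij).2 y hy
      have hb : b i j = 0 := by simpa [ha] using h0
      rw [ha, hb] at hx' hy'
      linarith
    refine ht ⟨(i, j), ?_⟩
    rw [div_eq_iff ha]
    linarith
  obtain ⟨B, m, n, hside⟩ : ∃ B m n : ι → ι → ℝ, ∀ i j, i ≠ j → ∀ p, side B m n i j p =
      u i j - (a i j * (shear t).symm p 0 + b i j * (shear t).symm p 1) := by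
    refine ⟨fun i j => -(b i j - t * a i j), fun i j => -a i j / (b i j - t * a i j),
      fun i j => u i j / (b i j - t * a i j), fun i j hij p => ?_⟩
    have := hb i j hij
    simp only [side, shear_symm_apply, Matrix.cons_val_zero, Matrix.cons_val_one]
    field_simp
    ring
  refine ⟨t, B, m, n, fun i => (ho i).preimage (shear t).symm.continuous,
    fun i => (hc i).is_linear_preimage (isLinearMap_shear_symm t),
    fun i => (hne i).preimage (shear t).symm.surjective, ?_, fun i j hij p hp => ?_,
    fun i j hij p hp => ?_⟩
  · rw [← Set.preimage_iUnion]
    exact hdense.preimage (shear t).symm.isOpenMap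
  · rw [hside i j hij]
    exact sub_pos.2 ((hau i j hij).1 _ hp)
  · rw [hside i j hij]
    exact sub_neg.2 ((hau i j hij).2 _ hp)

theorem isClosedHalfplane_preimage_shear (t : ℝ) {c : ℝ × ℝ × ℝ} (hc : NonconstAff c) :
    IsClosedHalfplane (shear t ⁻¹' {p | 0 ≤ aff c p}) := by
  refine ⟨![-c.1, -(c.1 * t + c.2.1)], fun h => ?_, c.2.2, ?_⟩
  · have h0 : -c.1 = 0 := congrFun h 0
    have h1 : -(c.1 * t + c.2.1) = 0 := congrFun h 1
    obtain h0 : c.1 = 0 := by linarith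
    rw [h0] at h1
    rcases hc with hc | hc
    · exact hc h0
    · exact hc (by linarith)
  · ext x
    simp only [Set.mem_preimage, Set.mem_ofPred_eq, aff, shear_apply, Matrix.cons_val_zero,
      Matrix.cons_val_one]
    constructor <;> intro h <;> linarith

theorem IsTri.preimage_shear {Δ : Set (ℝ × ℝ)} (h : IsTri Δ) (t : ℝ) :
    IsTriangleLike (shear t ⁻¹' Δ) := by
  obtain ⟨c₁, c₂, c₃, h₁, h₂, h₃, rfl⟩ := h
  refine ⟨_, _, _, isClosedHalfplane_preimage_shear t h₁, isClosedHalfplane_preimage_shear t h₂,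
    isClosedHalfplane_preimage_shear t h₃, ?_⟩
  ext x
  exact and_assoc.symm

/-! ### Corners of triangles -/

/-- Cramer's solution of `v 0 * x 0 + v 1 * x 1 = c`, `w 0 * x 0 + w 1 * x 1 = d`. -/
noncomputable def lineInter (v w : Plane) (c d : ℝ) : Plane :=
  ![(c * w 1 - d * v 1) / (v 0 * w 1 - v 1 * w 0), (d * v 0 - c * w 0) / (v 0 * w 1 - v 1 * w 0)]

theorem eq_lineInter {v w x : Plane} {c d : ℝ} (hdet : v 0 * w 1 - v 1 * w 0 ≠ 0)
    (hv : v 0 * x 0 + v 1 * x 1 = c) (hw : w 0 * x 0 + w 1 * x 1 = d) :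
    x = lineInter v w c d := by
  subst hv hw
  ext i
  fin_cases i
  · simp only [lineInter, Fin.zero_eta, Matrix.cons_val_zero]
    rw [eq_div_iff hdet]
    ring
  · simp only [lineInter, Fin.mk_one, Matrix.cons_val_one, Matrix.cons_val_fin_one]
    rw [eq_div_iff hdet]
    ring

theorem eq_zero_of_mem_extremePoints {ι : Type*} [Finite ι] {v : ι → Plane} {c : ι → ℝ}
    {x w : Plane} (hx : x ∈ Set.extremePoints ℝ {x | ∀ i, v i 0 * x 0 + v i 1 * x 1 ≤ c i})
    (hw : ∀ i, v i 0 * x 0 + v i 1 * x 1 = c i → v i 0 * w 0 + v i 1 * w 1 = 0) : w = 0 := by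
  have hmem : ∀ᶠ e : ℝ in nhds 0,
      x + e • w ∈ {x : Plane | ∀ i, v i 0 * x 0 + v i 1 * x 1 ≤ c i} := by
    refine Filter.eventually_all.2 fun i => ?_
    rcases (hx.1 i).lt_or_eq with hi | hi
    · have hcont : Continuous fun e : ℝ => v i 0 * (x + e • w) 0 + v i 1 * (x + e • w) 1 := by
        simp only [Pi.add_apply, Pi.smul_apply]
        fun_prop
      filter_upwards [hcont.continuousAt.eventually_lt
        (continuousAt_const (y := c i)) (by simpa using hi)] with e he using he.le
    · filter_upwards with e
      simp only [Pi.add_apply, Pi.smul_apply, smul_eq_mul]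
      linear_combination hi + e * hw i hi
  have hneg : ∀ᶠ e : ℝ in nhds 0,
      x + (-e) • w ∈ {x : Plane | ∀ i, v i 0 * x 0 + v i 1 * x 1 ≤ c i} :=
    (continuous_neg.tendsto' (0 : ℝ) 0 neg_zero).eventually hmem
  obtain ⟨e, ⟨he₁, he₂⟩, he⟩ := (((hmem.and hneg).filter_mono nhdsWithin_le_nhds).and
    (self_mem_nhdsWithin (s := Set.Ioi (0 : ℝ)))).exists
  have he' : e ≠ 0 := ne_of_gt he
  have := hx.2 he₁ he₂ ⟨1 / 2, 1 / 2, by norm_num, by norm_num, by norm_num, by module⟩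
  simpa [he'] using this

/-- A triangle has a bounded number of extreme points. -/
theorem IsTriangleLike.exists_extremePoints_subset {Δ : Set Plane} (h : IsTriangleLike Δ) :
    ∃ V : Finset Plane, V.card ≤ 9 ∧ Set.extremePoints ℝ Δ ⊆ V := by
  obtain ⟨_, _, _, ⟨v₁, h₁, c₁, rfl⟩, ⟨v₂, h₂, c₂, rfl⟩, ⟨v₃, h₃, c₃, rfl⟩, rfl⟩ := h
  set v : Fin 3 → Plane := ![v₁, v₂, v₃] with hv
  set c : Fin 3 → ℝ := ![c₁, c₂, c₃] with hc
  have hv0 : ∀ i, v i ≠ 0 := by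
    intro i
    fin_cases i <;> assumption
  have hΔ : {x : Plane | v₁ 0 * x 0 + v₁ 1 * x 1 ≤ c₁} ∩ {x | v₂ 0 * x 0 + v₂ 1 * x 1 ≤ c₂} ∩
      {x | v₃ 0 * x 0 + v₃ 1 * x 1 ≤ c₃} = {x | ∀ i, v i 0 * x 0 + v i 1 * x 1 ≤ c i} := by
    ext x
    simp [Fin.forall_fin_succ, hv, hc, and_assoc]
  refine ⟨Finset.univ.image fun k : Fin 3 × Fin 3 =>
    lineInter (v k.1) (v k.2) (c k.1) (c k.2), Finset.card_image_le.trans (by simp), ?_⟩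
  intro x hx
  rw [hΔ] at hx
  by_contra hxV
  have hdet : ∀ i j, v i 0 * x 0 + v i 1 * x 1 = c i → v j 0 * x 0 + v j 1 * x 1 = c j →
      v i 0 * v j 1 - v i 1 * v j 0 = 0 := by
    intro i j hi hj
    by_contra hne
    exact hxV (Finset.mem_image.2 ⟨(i, j), Finset.mem_univ _, (eq_lineInter hne hi hj).symm⟩)
  by_cases htight : ∃ i, v i 0 * x 0 + v i 1 * x 1 = c i
  · obtain ⟨i, hi⟩ := htight
    have hw : (![-v i 1, v i 0] : Plane) = 0 := by
      refine eq_zero_of_mem_extremePoints hx fun j hj => ?_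
      simp only [Matrix.cons_val_zero, Matrix.cons_val_one]
      linear_combination hdet i j hi hj
    have hw0 : -v i 1 = 0 := congrFun hw 0
    have hw1 : v i 0 = 0 := congrFun hw 1
    refine hv0 i ?_
    ext k
    fin_cases k
    · exact hw1
    · exact neg_eq_zero.1 hw0
  · exact one_ne_zero (eq_zero_of_mem_extremePoints (w := 1) hx
      fun i hi => absurd ⟨i, hi⟩ htight)

/-- Bambah–Rogers. If `m ≥ 3` convex pseudo-disks cover the
plane, then there are `O(m)` points `V` and a triangulation `T` of the plane
with all triangle corners in `V`, whose triangles are pairwise openly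
disjoint, cover the plane, and such that each triangle is contained in some
pseudo-disk. -/
theorem triangulation_of_pseudo_disk_cover :
    ∃ C : ℝ, 0 < C ∧
      ∀ 𝒟 : Finset (Set (Fin 2 → ℝ)), 3 ≤ 𝒟.card →
        IsPseudoDiskFamily 𝒟 → ⋃₀ (𝒟 : Set (Set (Fin 2 → ℝ))) = Set.univ →
        ∃ (V : Finset (Fin 2 → ℝ)) (T : Finset (Set (Fin 2 → ℝ))),
          (V.card : ℝ) ≤ C * 𝒟.card ∧ (T.card : ℝ) ≤ C * 𝒟.card ∧
          (∀ Δ ∈ T, IsTriangleLike Δ) ∧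
          (∀ Δ ∈ T, ∃ D ∈ 𝒟, Δ ⊆ D) ∧
          (∀ Δ₁ ∈ T, ∀ Δ₂ ∈ T, Δ₁ ≠ Δ₂ →
            interior Δ₁ ∩ interior Δ₂ = ∅) ∧
          ⋃₀ (T : Set (Set (Fin 2 → ℝ))) = Set.univ ∧
          (∀ Δ ∈ T, ∀ x ∈ Set.extremePoints ℝ Δ, x ∈ V) := by
  refine ⟨126, by norm_num, fun 𝒟 _ h𝒟 hcov => ?_⟩
  obtain ⟨W, hWo, hWc, hWD, hWd, hWdense⟩ := h𝒟.exists_disjoint_refinement hcov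
  have hdense : Dense (⋃ i : {i // (W i).Nonempty}, W i) := by
    refine hWdense.mono (Set.iUnion_subset fun i x hx => ?_)
    exact Set.mem_iUnion.2 ⟨⟨i, x, hx⟩, hx⟩
  obtain ⟨t, B, m, n, hW⟩ := exists_isCellFamily_shear (fun i : {i // (W i).Nonempty} => hWo i)
    (fun i => hWc i) (fun i => i.2) (fun i j hij => hWd (Subtype.coe_injective.ne hij)) hdense
  obtain ⟨S, hScard, hStri, hSdisj, hScov⟩ := hW.exists_tiling
  have hcard : S.card ≤ 14 * 𝒟.card := by
    refine hScard.trans (Nat.mul_le_mul_left _ ?_)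
    rw [← Fintype.card_coe 𝒟]
    exact Fintype.card_subtype_le _
  set T : Finset (Set Plane) := S.image fun Δ => shear t ⁻¹' Δ with hT
  have hTcard : T.card ≤ 14 * 𝒟.card := Finset.card_image_le.trans hcard
  have hTtri : ∀ Δ ∈ T, IsTriangleLike Δ := by
    intro Δ hΔ
    obtain ⟨Δ', hΔ', rfl⟩ := Finset.mem_image.1 hΔ
    exact (hStri Δ' hΔ').1.preimage_shear t
  choose! V hVcard hV using fun Δ (hΔ : Δ ∈ T) => (hTtri Δ hΔ).exists_extremePoints_subset
  refine ⟨T.biUnion V, T, ?_, ?_, hTtri, ?_, ?_, ?_, fun Δ hΔ x hx =>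
    Finset.mem_biUnion.2 ⟨Δ, hΔ, hV Δ hΔ hx⟩⟩
  · have h : (T.biUnion V).card ≤ 126 * 𝒟.card :=
      (Finset.card_biUnion_le_card_mul _ _ _ hVcard).trans (by omega)
    exact_mod_cast h
  · have h : T.card ≤ 126 * 𝒟.card := by omega
    exact_mod_cast h
  · intro Δ hΔ
    obtain ⟨Δ', hΔ', rfl⟩ := Finset.mem_image.1 hΔ
    obtain ⟨i, hi⟩ := (hStri Δ' hΔ').2
    refine ⟨i, i.1.2, fun x hx => closure_minimal (hWD i) (h𝒟.1 _ i.1.2).2 ?_⟩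
    have hx' := hi hx
    rw [← (shear t).symm.preimage_closure] at hx'
    simpa using hx'
  · intro Δ₁ h₁ Δ₂ h₂ hne
    obtain ⟨Δ₁', h₁', rfl⟩ := Finset.mem_image.1 h₁
    obtain ⟨Δ₂', h₂', rfl⟩ := Finset.mem_image.1 h₂
    rw [← (shear t).preimage_interior, ← (shear t).preimage_interior, ← Set.preimage_inter,
      hSdisj Δ₁' h₁' Δ₂' h₂' fun h => hne (by rw [h]), Set.preimage_empty]
  · refine Set.eq_univ_of_forall fun x => ?_
    obtain ⟨Δ, hΔ, hx⟩ := Set.mem_sUnion.1 (hScov.symm ▸ Set.mem_univ (shear t x))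
    exact Set.mem_sUnion.2 ⟨_, Finset.mem_coe.2 (Finset.mem_image_of_mem _ hΔ), hx⟩
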